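/- arXiv:2310.11820 — 5 statements merged into one kernel-verified Lean document; each statement's English description precedes it below -/
import Mathlib

section
/- Let g be a quasireductive finite-dimensional Lie superalgebra over F with Z(g)₀ = 0 and Z(g)₁ = 0. Then there exist subspaces r₀ ⊆ g₀ and r₁ ⊆ g₁ such that: g₀ = r₀ ⊕ C(g)₀ and g₁ = r₁ ⊕ C(g)₁; the pair r = (r₀, r₁) is a subalgebra of g, i.e. [r₀, r₀] ⊆ r₀ and r₀ • r₁ ⊆ r₁ and ⟨r₁, r₁⟩ ⊆ r₀; moreover ⟨r₁, r₁⟩ = 0, and x • v = 0 for every x in the span of {[a,b] : a, b ∈ r₀} and every v ∈ r₁. (Thus g is a semidirect product of C(g) and a subalgebra r ≅ R(g) whose odd part is abelian with trivial action of [r₀, r₀].) -/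
/- STATEMENT 9: if g is quasireductive with Z(g) = 0, then g is a semidirect product of
C(g) and a subalgebra r with abelian odd part on which [r₀, r₀] acts trivially. -/

variable {F : Type} [Field F] [IsAlgClosed F] [CharZero F]
variable {g0 : Type} [LieRing g0] [LieAlgebra F g0] [FiniteDimensional F g0]
variable {g1 : Type} [AddCommGroup g1] [Module F g1] [FiniteDimensional F g1]
variable [LieRingModule g0 g1] [LieModule F g0 g1]

/-- An ideal of the Lie superalgebra `(g0, g1, br)`. -/
def IsIdeal (br : g1 →ₗ[F] g1 →ₗ[F] g0)
    (l0 : Submodule F g0) (l1 : Submodule F g1) : Prop :=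
  (∀ a : g0, ∀ x ∈ l0, ⁅a, x⁆ ∈ l0) ∧
  (∀ a : g0, ∀ v ∈ l1, ⁅a, v⁆ ∈ l1) ∧
  (∀ x ∈ l0, ∀ v : g1, ⁅x, v⁆ ∈ l1) ∧
  (∀ v ∈ l1, ∀ w : g1, br v w ∈ l0)

/-- A minimal (nonzero) ideal of the Lie superalgebra `(g0, g1, br)`. -/
def IsMinimalIdeal (br : g1 →ₗ[F] g1 →ₗ[F] g0)
    (l0 : Submodule F g0) (l1 : Submodule F g1) : Prop :=
  IsIdeal br l0 l1 ∧ (l0 ≠ ⊥ ∨ l1 ≠ ⊥) ∧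
  ∀ m0 : Submodule F g0, ∀ m1 : Submodule F g1,
    IsIdeal br m0 m1 → m0 ≤ l0 → m1 ≤ l1 → (m0 ≠ ⊥ ∨ m1 ≠ ⊥) → m0 = l0 ∧ m1 = l1

/-- The even part of C(g), the sum of all minimal ideals of g. -/
noncomputable def CEven (br : g1 →ₗ[F] g1 →ₗ[F] g0) : Submodule F g0 :=
  sSup {m0 : Submodule F g0 | ∃ m1 : Submodule F g1, IsMinimalIdeal br m0 m1}

/-- The odd part of C(g), the sum of all minimal ideals of g. -/
noncomputable def COdd (br : g1 →ₗ[F] g1 →ₗ[F] g0) : Submodule F g1 :=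
  sSup {m1 : Submodule F g1 | ∃ m0 : Submodule F g0, IsMinimalIdeal br m0 m1}

set_option linter.unusedSectionVars false

/-- The projection of a Lie algebra onto its quotient by an ideal, as a Lie algebra morphism. -/
def quotientLieHom (I : LieIdeal F g0) : g0 →ₗ⁅F⁆ g0 ⧸ I :=
  { I.toSubmodule.mkQ with map_lie' := fun {_ _} => rfl }

theorem quotientLieHom_surjective (I : LieIdeal F g0) :
    Function.Surjective (quotientLieHom I) :=
  I.toSubmodule.mkQ_surjective

theorem quotientLieHom_eq_zero_iff (I : LieIdeal F g0) (x : g0) :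
    quotientLieHom I x = 0 ↔ x ∈ I :=
  Submodule.Quotient.mk_eq_zero I.toSubmodule

theorem hasTrivialRadical_quotient_center
    (hred : LieAlgebra.radical F g0 = LieAlgebra.center F g0) :
    LieAlgebra.HasTrivialRadical F (g0 ⧸ LieAlgebra.center F g0) := by
  rw [LieAlgebra.hasTrivialRadical_iff_no_abelian_ideals]
  intro I hI
  set π := quotientLieHom (LieAlgebra.center F g0) with hπ
  have hsol : LieAlgebra.IsSolvable (LieIdeal.comap π I) := by
    rw [LieAlgebra.isSolvable_iff F]
    refine ⟨2, ?_⟩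
    rw [LieIdeal.derivedSeries_eq_bot_iff]
    have h1 : LieAlgebra.derivedSeriesOfIdeal F g0 1 (LieIdeal.comap π I) ≤
        LieAlgebra.center F g0 := by
      rw [LieAlgebra.derivedSeriesOfIdeal_succ, LieAlgebra.derivedSeriesOfIdeal_zero,
        LieSubmodule.lie_le_iff]
      intro x hx y hy
      rw [← quotientLieHom_eq_zero_iff, LieHom.map_lie]
      rw [LieIdeal.mem_comap] at hx hy
      exact congrArg Subtype.val (hI.trivial ⟨_, hx⟩ ⟨_, hy⟩)
    rw [LieAlgebra.derivedSeriesOfIdeal_succ, LieSubmodule.lie_eq_bot_iff]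
    intro x _ y hy
    exact (LieModule.mem_maxTrivSubmodule F g0 g0 y).1 (h1 hy) x
  have hle : LieIdeal.comap π I ≤ LieAlgebra.center F g0 := by
    exact ((LieAlgebra.LieIdeal.solvable_iff_le_radical F g0 _).1 hsol).trans hred.le
  rw [eq_bot_iff]
  intro y hy
  obtain ⟨x, rfl⟩ := quotientLieHom_surjective (LieAlgebra.center F g0) y
  rw [LieSubmodule.mem_bot, quotientLieHom_eq_zero_iff]
  exact hle (LieIdeal.mem_comap.2 hy)

/-- In a Lie algebra whose radical is central and meets the derived algebra trivially, every
ideal has a complementary ideal. -/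
theorem exists_isCompl_lieIdeal
    (hred : LieAlgebra.radical F g0 = LieAlgebra.center F g0)
    (hder : Disjoint (LieAlgebra.center F g0) ⁅(⊤ : LieIdeal F g0), (⊤ : LieIdeal F g0)⁆)
    (I : LieIdeal F g0) : ∃ J : LieIdeal F g0, IsCompl I J := by
  have := hasTrivialRadical_quotient_center hred
  set Z := LieAlgebra.center F g0 with hZ
  set D : LieIdeal F g0 := ⁅(⊤ : LieIdeal F g0), (⊤ : LieIdeal F g0)⁆ with hD
  have hπ := quotientLieHom_surjective Z
  set π := quotientLieHom Z
  set I' := LieIdeal.map π I with hI'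
  have hc := LieIdeal.isCompl_killingCompl I'
  set J := LieIdeal.comap π I'.killingCompl with hJ
  have hIJ : I ⊓ J ≤ Z := by
    rintro x ⟨hx, hx'⟩
    rw [← quotientLieHom_eq_zero_iff]
    exact (LieSubmodule.mem_bot _).1 (hc.1.le_bot ⟨LieIdeal.mem_map hx, LieIdeal.mem_comap.1 hx'⟩)
  have hZJ : Z ≤ J := fun x hx => by
    rw [hJ, LieIdeal.mem_comap, (quotientLieHom_eq_zero_iff Z x).2 hx]
    exact zero_mem _
  have hsup : I ⊔ J = ⊤ := by
    rw [eq_top_iff]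
    intro x _
    have hx : π x ∈ I' ⊔ I'.killingCompl := by rw [hc.sup_eq_top]; trivial
    obtain ⟨y, hy, z, hz, hyz⟩ := (LieSubmodule.mem_sup _ _ _).1 hx
    obtain ⟨a, ha⟩ := LieIdeal.mem_map_of_surjective hπ hy
    refine (LieSubmodule.mem_sup _ _ _).2 ⟨a, a.2, x - a, ?_, by simp⟩
    rw [hJ, LieIdeal.mem_comap, map_sub, ← hyz, ha]
    simpa using hz
  have hdis : Disjoint (I ⊓ J).toSubmodule (J ⊓ D).toSubmodule := by
    rw [LieSubmodule.disjoint_toSubmodule]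
    exact hder.mono hIJ inf_le_right
  obtain ⟨K, hK⟩ := exists_isCompl ((I ⊓ J).toSubmodule ⊔ (J ⊓ D).toSubmodule)
  let J' : LieIdeal F g0 :=
    { ((J ⊓ D).toSubmodule ⊔ (K ⊓ J.toSubmodule)) with
      lie_mem := fun {a x} hx => by
        have hxJ : x ∈ J := by
          have : (J ⊓ D).toSubmodule ⊔ (K ⊓ J.toSubmodule) ≤ J.toSubmodule :=
            sup_le (fun _ h => h.1) inf_le_right
          exact this hx
        exact Submodule.mem_sup_left
          ⟨J.lie_mem hxJ, LieSubmodule.lie_mem_lie (by trivial) (by trivial)⟩ }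
  have hJ'J : J' ≤ J := fun x hx => by
    have : (J ⊓ D).toSubmodule ⊔ (K ⊓ J.toSubmodule) ≤ J.toSubmodule :=
      sup_le (fun _ h => h.1) inf_le_right
    exact this hx
  refine ⟨J', ?_, ?_⟩
  · rw [disjoint_iff, eq_bot_iff]
    rintro x ⟨hxI, hxJ'⟩
    have hxJ := hJ'J hxJ'
    obtain ⟨y, hy, z, hz, rfl⟩ := Submodule.mem_sup.1 hxJ'
    have hz0 : z = 0 := by
      have h1 : z ∈ (I ⊓ J).toSubmodule ⊔ (J ⊓ D).toSubmodule := by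
        have : z = (y + z) - y := by abel
        rw [this]
        exact sub_mem (Submodule.mem_sup_left ⟨hxI, hxJ⟩) (Submodule.mem_sup_right hy)
      simpa using hK.1.le_bot ⟨h1, hz.1⟩
    subst hz0
    rw [add_zero] at *
    simpa using hdis.le_bot ⟨⟨hxI, hxJ⟩, hy⟩
  · rw [codisjoint_iff, eq_top_iff]
    intro x _
    have hx : x ∈ I ⊔ J := by rw [hsup]; trivial
    obtain ⟨a, ha, b, hb, rfl⟩ := (LieSubmodule.mem_sup _ _ _).1 hx
    have hb' : b ∈ ((I ⊓ J).toSubmodule ⊔ (J ⊓ D).toSubmodule) ⊔ K := by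
      rw [hK.sup_eq_top]; trivial
    obtain ⟨p, hp, q, hq, rfl⟩ := Submodule.mem_sup.1 hb'
    obtain ⟨c, hc, d, hd, rfl⟩ := Submodule.mem_sup.1 hp
    have hqJ : q ∈ J := by
      have : q = (c + d + q) - c - d := by abel
      rw [this]
      exact sub_mem (sub_mem hb hc.2) hd.1
    refine (LieSubmodule.mem_sup _ _ _).2 ⟨a + c, add_mem ha hc.1, d + q, ?_, by abel⟩
    exact add_mem (Submodule.mem_sup_left hd) (Submodule.mem_sup_right ⟨hq, hqJ⟩)

/-- A central element of the derived algebra acts as zero on any completely reducible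
finite-dimensional module. -/
theorem lie_eq_zero_of_mem_center_of_mem_derived
    (hss : ∀ N : LieSubmodule F g0 g1, ∃ N', IsCompl N N') {z : g0}
    (hz : z ∈ LieAlgebra.center F g0)
    (hz' : z ∈ ⁅(⊤ : LieIdeal F g0), (⊤ : LieIdeal F g0)⁆) (v : g1) : ⁅z, v⁆ = 0 := by
  have hcomm : ∀ (a : g0) (w : g1), ⁅z, ⁅a, w⁆⁆ = ⁅a, ⁅z, w⁆⁆ := fun a w => by
    rw [leibniz_lie, ← lie_skew, (LieModule.mem_maxTrivSubmodule F g0 g0 z).1 hz a]; simp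
  let E : F → LieSubmodule F g0 g1 := fun μ =>
    { carrier := {w | ⁅z, w⁆ = μ • w}
      zero_mem' := by simp
      add_mem' := fun {x y} hx hy => by
        simp only [Set.mem_ofPred_eq] at *; rw [lie_add, hx, hy, smul_add]
      smul_mem' := fun c x hx => by
        simp only [Set.mem_ofPred_eq] at *; rw [lie_smul, hx, smul_comm]
      lie_mem := fun {a x} hx => by
        change ⁅z, x⁆ = μ • x at hx
        change ⁅z, ⁅a, x⁆⁆ = μ • ⁅a, x⁆
        rw [hcomm, hx, lie_smul] }
  have hE : ∀ (μ : F) (w : g1), ⁅z, w⁆ = μ • w → w ≠ 0 → μ = 0 := by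
    intro μ w hw hw0
    have htr : LinearMap.trace F _ (LieModule.toEnd F g0 (E μ) z) = 0 := by
      refine LieModule.trace_toEnd_eq_zero_of_mem_lcs F g0 (E μ) le_rfl (k := 1) ?_
      rwa [LieModule.lowerCentralSeries_succ, LieModule.lowerCentralSeries_zero]
    have hsc : LieModule.toEnd F g0 (E μ) z = μ • LinearMap.id := by
      ext ⟨x, hx⟩; exact hx
    rw [hsc, map_smul, LinearMap.trace_id, smul_eq_mul, mul_eq_zero] at htr
    refine htr.resolve_right ?_
    have : Nontrivial (E μ) := ⟨⟨⟨w, hw⟩, 0, fun h => hw0 (congrArg Subtype.val h)⟩⟩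
    exact_mod_cast (Module.finrank_pos (R := F) (M := E μ)).ne'
  obtain ⟨N', hN'⟩ := hss (E 0)
  suffices h : N' = ⊥ by
    have : v ∈ E 0 := by
      have := hN'.sup_eq_top
      rw [h, sup_bot_eq] at this
      rw [this]; trivial
    simpa using (show ⁅z, v⁆ = (0 : F) • v from this)
  by_contra hne
  have : Nontrivial N' := (LieSubmodule.nontrivial_iff_ne_bot F g0 g1).2 hne
  obtain ⟨μ, hμ⟩ := Module.End.exists_eigenvalue (LieModule.toEnd F g0 N' z)
  obtain ⟨w, hw⟩ := hμ.exists_hasEigenvector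
  have hw1 : ⁅z, (w : g1)⁆ = μ • (w : g1) := congrArg Subtype.val hw.apply_eq_smul
  have hw0 : (w : g1) ≠ 0 := fun h => hw.2 (Subtype.ext h)
  have hμ0 := hE μ w hw1 hw0
  subst hμ0
  exact hw0 (by simpa using hN'.1.le_bot ⟨hw1, w.2⟩)

theorem IsIdeal.exists_isMinimalIdeal_le {br : g1 →ₗ[F] g1 →ₗ[F] g0}
    {l0 : Submodule F g0} {l1 : Submodule F g1} (hl : IsIdeal br l0 l1)
    (hne : l0 ≠ ⊥ ∨ l1 ≠ ⊥) :
    ∃ m0 m1, IsMinimalIdeal br m0 m1 ∧ m0 ≤ l0 ∧ m1 ≤ l1 := by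
  obtain ⟨⟨m0, m1⟩, ⟨hm, hmne, hm0, hm1⟩, hmin⟩ := WellFounded.has_min
    (wellFounded_lt (α := Submodule F g0 × Submodule F g1))
    {p | IsIdeal br p.1 p.2 ∧ (p.1 ≠ ⊥ ∨ p.2 ≠ ⊥) ∧ p.1 ≤ l0 ∧ p.2 ≤ l1}
    ⟨(l0, l1), hl, hne, le_rfl, le_rfl⟩
  refine ⟨m0, m1, ⟨hm, hmne, fun n0 n1 hn h0 h1 hnne => ?_⟩, hm0, hm1⟩
  by_contra hcon
  refine hmin (n0, n1) ⟨hn, hnne, h0.trans hm0, h1.trans hm1⟩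
    (lt_of_le_of_ne ⟨h0, h1⟩ fun he => hcon ?_)
  simpa using he

/-- The even part of an ideal, as an ideal of the Lie algebra `g0`. -/
def IsIdeal.even {br : g1 →ₗ[F] g1 →ₗ[F] g0} {l0 : Submodule F g0} {l1 : Submodule F g1}
    (hl : IsIdeal br l0 l1) : LieIdeal F g0 :=
  { l0 with lie_mem := fun {a x} hx => hl.1 a x hx }

/-- The odd part of an ideal, as a submodule of the `g0`-module `g1`. -/
def IsIdeal.odd {br : g1 →ₗ[F] g1 →ₗ[F] g0} {l0 : Submodule F g0} {l1 : Submodule F g1}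
    (hl : IsIdeal br l0 l1) : LieSubmodule F g0 g1 :=
  { l1 with lie_mem := fun {a x} hx => hl.2.1 a x hx }

theorem IsMinimalIdeal.even_le_CEven {br : g1 →ₗ[F] g1 →ₗ[F] g0} {l0 : Submodule F g0}
    {l1 : Submodule F g1} (hl : IsMinimalIdeal br l0 l1) : l0 ≤ CEven br :=
  le_sSup (Exists.intro l1 hl)

theorem IsMinimalIdeal.odd_le_COdd {br : g1 →ₗ[F] g1 →ₗ[F] g0} {l0 : Submodule F g0}
    {l1 : Submodule F g1} (hl : IsMinimalIdeal br l0 l1) : l1 ≤ COdd br :=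
  le_sSup (Exists.intro l0 hl)

theorem isIdeal_CEven_COdd (br : g1 →ₗ[F] g1 →ₗ[F] g0) :
    IsIdeal br (CEven br) (COdd br) := by
  refine ⟨fun a => ?_, fun a => ?_, fun x hx v => ?_, fun v hv w => ?_⟩
  · suffices h : CEven br ≤ (CEven br).comap (LieModule.toEnd F g0 g0 a) from fun x hx => h hx
    refine sSup_le fun m0 ⟨m1, hm⟩ x hx => ?_
    exact hm.even_le_CEven (hm.1.1 a x hx)
  · suffices h : COdd br ≤ (COdd br).comap (LieModule.toEnd F g0 g1 a) from fun x hx => h hx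
    refine sSup_le fun m1 ⟨m0, hm⟩ x hx => ?_
    exact hm.odd_le_COdd (hm.1.2.1 a x hx)
  · suffices h : CEven br ≤ (COdd br).comap
      ((LieModule.toEnd F g0 g1 : g0 →ₗ[F] Module.End F g1).flip v) from h hx
    refine sSup_le fun m0 ⟨m1, hm⟩ x hx => ?_
    exact hm.odd_le_COdd (hm.1.2.2.1 x hx v)
  · suffices h : COdd br ≤ (CEven br).comap (br.flip w) from h hv
    refine sSup_le fun m1 ⟨m0, hm⟩ x hx => ?_
    exact hm.even_le_CEven (hm.1.2.2.2 x hx w)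

/-- The vectors of the module annihilated by an ideal. -/
def idealInvariants (S : LieIdeal F g0) : LieSubmodule F g0 g1 where
  carrier := {v | ∀ x ∈ S, ⁅x, v⁆ = 0}
  zero_mem' := by simp
  add_mem' {v w} hv hw x hx := by rw [lie_add, hv x hx, hw x hx, add_zero]
  smul_mem' c v hv x hx := by rw [lie_smul, hv x hx, smul_zero]
  lie_mem {a v} hv x hx := by
    change ∀ x ∈ S, ⁅x, v⁆ = 0 at hv
    rw [leibniz_lie, hv x hx, lie_zero, add_zero]
    exact hv _ (lie_mem_left F g0 S x a hx)

theorem isCompl_lie_top_idealInvariants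
    (hss : ∀ N : LieSubmodule F g0 g1, ∃ N', IsCompl N N') (S : LieIdeal F g0) :
    IsCompl ⁅S, (⊤ : LieSubmodule F g0 g1)⁆ (idealInvariants S) := by
  constructor
  · obtain ⟨N, hN⟩ := hss (idealInvariants S)
    refine Disjoint.mono_left ?_ hN.1.symm
    rw [LieSubmodule.lie_le_iff]
    intro x hx v _
    have hv : v ∈ idealInvariants (F := F) S ⊔ N := by rw [hN.sup_eq_top]; trivial
    obtain ⟨y, hy, z, hz, rfl⟩ := (LieSubmodule.mem_sup _ _ _).1 hv
    rw [lie_add, hy x hx, zero_add]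
    exact N.lie_mem hz
  · obtain ⟨N, hN⟩ := hss ⁅S, (⊤ : LieSubmodule F g0 g1)⁆
    refine hN.2.mono_right fun v hv x hx => ?_
    have := hN.1.le_bot ⟨LieSubmodule.lie_mem_lie hx (LieSubmodule.mem_top v), N.lie_mem hv⟩
    simpa using this

/-- The even part of the centralizer of a pair `(c0, c1)`. -/
def centralizerEven (c0 : Submodule F g0) (c1 : Submodule F g1) : Submodule F g0 where
  carrier := {x | (∀ c ∈ c0, ⁅c, x⁆ = 0) ∧ ∀ v ∈ c1, ⁅x, v⁆ = 0}
  zero_mem' := by simp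
  add_mem' {x y} hx hy := ⟨fun c hc => by rw [lie_add, hx.1 c hc, hy.1 c hc, add_zero],
    fun v hv => by rw [add_lie, hx.2 v hv, hy.2 v hv, add_zero]⟩
  smul_mem' r x hx := ⟨fun c hc => by rw [lie_smul, hx.1 c hc, smul_zero],
    fun v hv => by rw [smul_lie, hx.2 v hv, smul_zero]⟩

/-- The odd part of the centralizer of a pair `(c0, c1)`. -/
def centralizerOdd (br : g1 →ₗ[F] g1 →ₗ[F] g0) (c0 : Submodule F g0) (c1 : Submodule F g1) :
    Submodule F g1 where
  carrier := {v | (∀ c ∈ c0, ⁅c, v⁆ = 0) ∧ ∀ w ∈ c1, br v w = 0}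
  zero_mem' := by simp
  add_mem' {x y} hx hy := ⟨fun c hc => by rw [lie_add, hx.1 c hc, hy.1 c hc, add_zero],
    fun v hv => by rw [map_add, LinearMap.add_apply, hx.2 v hv, hy.2 v hv, add_zero]⟩
  smul_mem' r x hx := ⟨fun c hc => by rw [lie_smul, hx.1 c hc, smul_zero],
    fun v hv => by rw [map_smul, LinearMap.smul_apply, hx.2 v hv, smul_zero]⟩

/-- `(g0, g1, br)` is a quasireductive Lie superalgebra with trivial center. -/
structure IsCenterlessQuasireductive (br : g1 →ₗ[F] g1 →ₗ[F] g0) : Prop where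
  symm : ∀ v w : g1, br v w = br w v
  equiv : ∀ (a : g0) (v w : g1), ⁅a, br v w⁆ = br ⁅a, v⁆ w + br v ⁅a, w⁆
  jac : ∀ u v w : g1, ⁅br u v, w⁆ + ⁅br v w, u⁆ + ⁅br w u, v⁆ = 0
  red : LieAlgebra.radical F g0 = LieAlgebra.center F g0
  ss : ∀ N : LieSubmodule F g0 g1, ∃ N', IsCompl N N'
  center_even : ∀ x : g0, (∀ a : g0, ⁅x, a⁆ = 0) → (∀ v : g1, ⁅x, v⁆ = 0) → x = 0
  center_odd : ∀ v : g1, (∀ a : g0, ⁅a, v⁆ = 0) → (∀ w : g1, br v w = 0) → v = 0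

namespace IsCenterlessQuasireductive

variable {br : g1 →ₗ[F] g1 →ₗ[F] g0}

theorem exists_isCompl (h : IsCenterlessQuasireductive br) (I : LieIdeal F g0) :
    ∃ J : LieIdeal F g0, IsCompl I J := by
  refine exists_isCompl_lieIdeal h.red ?_ I
  rw [disjoint_iff, eq_bot_iff]
  rintro z ⟨hz, hz'⟩
  refine (LieSubmodule.mem_bot _).2 (h.center_even z (fun a => ?_)
    (lie_eq_zero_of_mem_center_of_mem_derived h.ss hz hz'))
  rw [← lie_skew, (LieModule.mem_maxTrivSubmodule F g0 g0 z).1 hz a, neg_zero]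

theorem lie_br_eq (h : IsCenterlessQuasireductive br) (u v w : g1) :
    ⁅br u v, w⁆ = -⁅br v w, u⁆ - ⁅br u w, v⁆ := by
  have := h.jac u v w
  rw [h.symm w u, add_assoc, add_eq_zero_iff_eq_neg] at this
  rw [this]; abel

theorem br_lie_left (h : IsCenterlessQuasireductive br) (a : g0) (v w : g1) :
    br ⁅a, v⁆ w = ⁅a, br v w⁆ - br v ⁅a, w⁆ := by
  rw [h.equiv]; abel

/-- The ideal of `g0` spanned by the brackets of two submodules of `g1`. -/
def bracketIdeal (h : IsCenterlessQuasireductive br) (M N : LieSubmodule F g0 g1) :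
    LieIdeal F g0 :=
  { Submodule.map₂ br M.toSubmodule N.toSubmodule with
    lie_mem := fun {a x} hx => by
      suffices hle : Submodule.map₂ br M.toSubmodule N.toSubmodule ≤
        (Submodule.map₂ br M.toSubmodule N.toSubmodule).comap (LieModule.toEnd F g0 g0 a) from
        hle hx
      rw [Submodule.map₂_le]
      intro m hm n hn
      change ⁅a, br m n⁆ ∈ Submodule.map₂ br M.toSubmodule N.toSubmodule
      rw [h.equiv]
      exact add_mem (Submodule.apply_mem_map₂ _ (M.lie_mem hm) hn)
        (Submodule.apply_mem_map₂ _ hm (N.lie_mem hn)) }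

theorem br_mem_bracketIdeal (h : IsCenterlessQuasireductive br) {M N : LieSubmodule F g0 g1}
    {m n : g1} (hm : m ∈ M) (hn : n ∈ N) : br m n ∈ h.bracketIdeal M N :=
  Submodule.apply_mem_map₂ br hm hn

theorem bracketIdeal_toSubmodule_le (h : IsCenterlessQuasireductive br)
    {M N : LieSubmodule F g0 g1} {p : Submodule F g0}
    (hp : ∀ m ∈ M, ∀ n ∈ N, br m n ∈ p) : (h.bracketIdeal M N).toSubmodule ≤ p :=
  (Submodule.map₂_le (f := br) (p := M.toSubmodule) (q := N.toSubmodule)).2 hp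

theorem lie_eq_zero_of_mem_bracketIdeal (h : IsCenterlessQuasireductive br)
    {M N : LieSubmodule F g0 g1} {v : g1} (hv : ∀ m ∈ M, ∀ n ∈ N, ⁅br m n, v⁆ = 0)
    {x : g0} (hx : x ∈ h.bracketIdeal M N) : ⁅x, v⁆ = 0 :=
  h.bracketIdeal_toSubmodule_le
    (p := LinearMap.ker ((LieModule.toEnd F g0 g1 : g0 →ₗ[F] Module.End F g1).flip v)) hv hx

theorem isIdeal_centralizer (h : IsCenterlessQuasireductive br)
    {c0 : Submodule F g0} {c1 : Submodule F g1} (hc : IsIdeal br c0 c1) :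
    IsIdeal br (centralizerEven c0 c1) (centralizerOdd br c0 c1) := by
  obtain ⟨hc1, hc2, hc3, hc4⟩ := hc
  have hc1' : ∀ a : g0, ∀ x ∈ c0, ⁅x, a⁆ ∈ c0 := fun a x hx => by
    rw [← lie_skew]; exact neg_mem (hc1 a x hx)
  refine ⟨fun a x hx => ⟨fun c hc => ?_, fun v hv => ?_⟩,
    fun a v hv => ⟨fun c hc => ?_, fun w hw => ?_⟩,
    fun x hx v => ⟨fun c hc => ?_, fun w hw => ?_⟩,
    fun v hv u => ⟨fun c hc => ?_, fun w hw => ?_⟩⟩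
  · rw [leibniz_lie, hx.1 _ (hc1' a c hc), hx.1 c hc, lie_zero, add_zero]
  · rw [lie_lie, hx.2 v hv, hx.2 _ (hc2 a v hv), lie_zero, sub_zero]
  · rw [leibniz_lie, hv.1 _ (hc1' a c hc), hv.1 c hc, lie_zero, add_zero]
  · rw [h.br_lie_left, hv.2 w hw, hv.2 _ (hc2 a w hw), lie_zero, sub_zero]
  · rw [leibniz_lie, hx.1 c hc, zero_lie, hx.2 _ (hc3 c hc v), add_zero]
  · have hwv : ⁅br v w, x⁆ = 0 := hx.1 _ (by rw [h.symm]; exact hc4 w hw v)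
    rw [h.br_lie_left, hx.2 w hw, map_zero, sub_zero, ← lie_skew, hwv, neg_zero]
  · rw [h.equiv, hv.1 c hc, hv.2 _ (hc3 c hc u), map_zero, LinearMap.zero_apply, add_zero]
  · rw [h.lie_br_eq, hv.2 w hw, zero_lie, hv.1 _ (by rw [h.symm]; exact hc4 w hw u)]
    simp

theorem even_eq_bot_of_abelian (h : IsCenterlessQuasireductive br)
    {l0 : Submodule F g0} {l1 : Submodule F g1} (hl : IsIdeal br l0 l1)
    (h00 : ∀ x ∈ l0, ∀ y ∈ l0, ⁅x, y⁆ = 0) (h01 : ∀ x ∈ l0, ∀ v ∈ l1, ⁅x, v⁆ = 0) :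
    l0 = ⊥ := by
  have hab : IsLieAbelian hl.even := ⟨fun x y => Subtype.ext (h00 x x.2 y y.2)⟩
  have hle : hl.even ≤ LieAlgebra.center F g0 :=
    ((LieAlgebra.LieIdeal.solvable_iff_le_radical F g0 _).1
      (LieAlgebra.ofAbelianIsSolvable _)).trans h.red.le
  have hinv := isCompl_lie_top_idealInvariants h.ss hl.even
  rw [eq_bot_iff]
  intro x hx
  have hxc : ∀ a, ⁅a, x⁆ = 0 := (LieModule.mem_maxTrivSubmodule F g0 g0 x).1 (hle hx)
  refine h.center_even x (fun a => by rw [← lie_skew, hxc, neg_zero]) fun v => ?_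
  have := hinv.1.le_bot ⟨LieSubmodule.lie_mem_lie (show x ∈ hl.even from hx)
    (LieSubmodule.mem_top v), fun y hy => h01 y hy _ (hl.2.2.1 x hx v)⟩
  simpa using this

theorem even_eq_bot_of_le_centralizer (h : IsCenterlessQuasireductive br)
    {l0 : Submodule F g0} {l1 : Submodule F g1} (hl : IsMinimalIdeal br l0 l1)
    (hle : l0 ≤ centralizerEven (CEven br) (COdd br)) : l0 = ⊥ :=
  h.even_eq_bot_of_abelian hl.1
    (fun _ hx _ hy => (hle hy).1 _ (hl.even_le_CEven hx))
    (fun _ hx _ hv => (hle hx).2 _ (hl.odd_le_COdd hv))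

/-- The odd part of the centralizer of `C(g)` brackets trivially with everything odd. -/
theorem br_eq_zero_of_mem_centralizerOdd (h : IsCenterlessQuasireductive br) {p : g1}
    (hp : p ∈ centralizerOdd br (CEven br) (COdd br)) (v : g1) : br p v = 0 := by
  have hP := h.isIdeal_centralizer (isIdeal_CEven_COdd br)
  set J := h.bracketIdeal hP.odd ⊤ with hJ
  set X := ⁅J, (⊤ : LieSubmodule F g0 g1)⁆ with hX
  have hJP : J.toSubmodule ≤ centralizerEven (CEven br) (COdd br) :=
    h.bracketIdeal_toSubmodule_le fun m hm n _ => hP.2.2.2 m hm n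
  have hXP : X ≤ hP.odd := by
    rw [hX, LieSubmodule.lie_le_iff]
    exact fun x hx w _ => hP.2.2.1 x (hJP hx) w
  have hI : IsIdeal br J.toSubmodule X.toSubmodule :=
    ⟨fun a x hx => J.lie_mem hx, fun a w hw => X.lie_mem hw,
      fun x hx w => LieSubmodule.lie_mem_lie hx (LieSubmodule.mem_top w),
      fun w hw u => h.br_mem_bracketIdeal (hXP hw) (LieSubmodule.mem_top u)⟩
  have hbot : J.toSubmodule = ⊥ := by
    by_contra hne
    obtain ⟨l0, l1, hl, h0, h1⟩ := hI.exists_isMinimalIdeal_le (Or.inl hne)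
    have hl0 := h.even_eq_bot_of_le_centralizer hl (h0.trans hJP)
    have hbr : ∀ a ∈ l1, ∀ w, br a w = 0 := fun a ha w => by
      simpa [hl0] using hl.1.2.2.2 a ha w
    refine (hl.2.1.resolve_left (not_not.2 hl0)) (eq_bot_iff.2 fun a ha => ?_)
    have hinv : a ∈ idealInvariants (F := F) J := fun x hx =>
      h.lie_eq_zero_of_mem_bracketIdeal (fun m _ n _ => by
        rw [h.lie_br_eq, h.symm n, h.symm m, hbr a ha, hbr a ha]; simp) hx
    simpa using (isCompl_lie_top_idealInvariants h.ss J).1.le_bot ⟨h1 ha, hinv⟩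
  have : br p v ∈ J.toSubmodule := h.br_mem_bracketIdeal hp (LieSubmodule.mem_top v)
  simpa [hbot] using this

variable {T : LieSubmodule F g0 g1}

theorem eq_zero_of_mem_centralizerOdd (h : IsCenterlessQuasireductive br)
    (hT : Disjoint T.toSubmodule (COdd br)) {t : g1} (ht : t ∈ T)
    (htc : t ∈ centralizerOdd br (CEven br) (COdd br)) : t = 0 := by
  have hP := h.isIdeal_centralizer (isIdeal_CEven_COdd br)
  set N := T ⊓ hP.odd with hN
  have hI : IsIdeal br ⊥ N.toSubmodule := by
    refine ⟨by simp, fun a w hw => N.lie_mem hw, by simp, fun w hw u => ?_⟩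
    simpa using h.br_eq_zero_of_mem_centralizerOdd hw.2 u
  suffices hbot : N.toSubmodule = ⊥ by
    have : t ∈ N.toSubmodule := ⟨ht, htc⟩
    simpa [hbot] using this
  by_contra hne
  obtain ⟨l0, l1, hl, h0, h1⟩ := hI.exists_isMinimalIdeal_le (Or.inr hne)
  refine (hl.2.1.resolve_left (not_not.2 (le_bot_iff.1 h0))) (le_bot_iff.1 ?_)
  exact fun a ha => hT.le_bot ⟨(h1 ha).1, hl.odd_le_COdd ha⟩

theorem lie_eq_zero_of_mem_CEven (hT : Disjoint T.toSubmodule (COdd br)) {c : g0}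
    (hc : c ∈ CEven br) {t : g1} (ht : t ∈ T) : ⁅c, t⁆ = 0 := by
  simpa using hT.le_bot ⟨T.lie_mem ht, (isIdeal_CEven_COdd br).2.2.1 c hc t⟩

theorem br_eq_zero_of_isCompl (h : IsCenterlessQuasireductive br)
    (hT : IsCompl T.toSubmodule (COdd br)) {s t : g1} (hs : s ∈ T) (ht : t ∈ T) :
    br s t = 0 := by
  have hC := isIdeal_CEven_COdd br
  have hP := h.isIdeal_centralizer hC
  have hCT : ∀ c ∈ CEven br, ∀ t ∈ T, ⁅c, t⁆ = 0 :=
    fun c hc t ht => lie_eq_zero_of_mem_CEven hT.1 hc ht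
  set B := h.bracketIdeal T T with hB
  have hBP : B.toSubmodule ≤ centralizerEven (CEven br) (COdd br) := by
    refine h.bracketIdeal_toSubmodule_le fun m hm n hn => ⟨fun c hc => ?_, fun v hv => ?_⟩
    · rw [h.equiv, hCT c hc m hm, hCT c hc n hn]; simp
    · rw [h.lie_br_eq, h.symm n, h.symm m, hCT _ (hC.2.2.2 v hv n) m hm,
        hCT _ (hC.2.2.2 v hv m) n hn]; simp
  have hBT : ∀ x ∈ B, ∀ t ∈ T, ⁅x, t⁆ = 0 := fun x hx t ht =>
    h.eq_zero_of_mem_centralizerOdd hT.1 (T.lie_mem ht) (hP.2.2.1 x (hBP hx) t)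
  have hBg : ∀ x ∈ B, ∀ v : g1, ⁅x, v⁆ = 0 := fun x hx v => by
    have hv : v ∈ T.toSubmodule ⊔ COdd br := by rw [hT.sup_eq_top]; trivial
    obtain ⟨y, hy, z, hz, rfl⟩ := Submodule.mem_sup.1 hv
    rw [lie_add, hBT x hx y hy, (hBP hx).2 z hz, add_zero]
  have hI : IsIdeal br B.toSubmodule ⊥ :=
    ⟨fun a x hx => B.lie_mem hx, by simp, fun x hx v => by simpa using hBg x hx v, by simp⟩
  have hbot : B.toSubmodule = ⊥ := by
    refine h.even_eq_bot_of_abelian hI (fun x hx y hy => ?_) (fun x hx v _ => hBg x hx v)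
    refine h.bracketIdeal_toSubmodule_le
      (p := LinearMap.ker (LieModule.toEnd F g0 g0 x)) (fun m hm n hn => ?_) hy
    change ⁅x, br m n⁆ = 0
    rw [h.equiv, hBg x hx, hBg x hx]; simp
  have : br s t ∈ B.toSubmodule := h.br_mem_bracketIdeal hs ht
  simpa [hbot] using this

/-- In a minimal ideal `l`, any nonzero ideal of `g0` contained in the span of `⟨T, l₁⟩`
generates all of `l`. -/
theorem eq_even_and_lie_top_eq_odd (h : IsCenterlessQuasireductive br)
    {l0 : Submodule F g0} {l1 : Submodule F g1} (hl : IsMinimalIdeal br l0 l1)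
    (hlT : ∀ c ∈ l0, ∀ t ∈ T, ⁅c, t⁆ = 0) {S : LieIdeal F g0} (hS : S ≠ ⊥)
    (hSE : S ≤ h.bracketIdeal T hl.1.odd) :
    S.toSubmodule = l0 ∧ ⁅S, (⊤ : LieSubmodule F g0 g1)⁆.toSubmodule = l1 := by
  obtain ⟨hl1, hl2, hl3, hl4⟩ := hl.1
  have hl4' : ∀ v ∈ l1, ∀ w, br w v ∈ l0 := fun v hv w => by rw [h.symm]; exact hl4 v hv w
  have hSl : ∀ x ∈ S, x ∈ l0 := fun x hx =>
    h.bracketIdeal_toSubmodule_le (fun m _ n hn => hl4' n hn m) (hSE hx)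
  set X := ⁅S, (⊤ : LieSubmodule F g0 g1)⁆ with hX
  set Y : LieSubmodule F g0 g1 := idealInvariants S with hY
  have hXY : IsCompl X Y := isCompl_lie_top_idealInvariants h.ss S
  have hSX : ∀ x ∈ S, ∀ v : g1, ⁅x, v⁆ ∈ X := fun x hx v =>
    LieSubmodule.lie_mem_lie hx (LieSubmodule.mem_top v)
  have hXl : X ≤ hl.1.odd := by
    rw [hX, LieSubmodule.lie_le_iff]
    exact fun x hx w _ => hl3 x (hSl x hx) w
  have X_induction : ∀ p : Submodule F g1, (∀ x ∈ S, ∀ v : g1, ⁅x, v⁆ ∈ p) →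
      ∀ w ∈ X, w ∈ p := fun p hp w hw => by
    have hw' : w ∈ X.toSubmodule := hw
    rw [hX, LieSubmodule.lieIdeal_oper_eq_linear_span'] at hw'
    refine Submodule.span_le.2 ?_ hw'
    rintro _ ⟨x, hx, v, _, rfl⟩
    exact hp x hx v
  have hbrXY : ∀ k ∈ X, ∀ y ∈ Y, br k y ∈ S := fun k hk y hy => by
    refine X_induction (S.toSubmodule.comap (br.flip y)) (fun x hx v => ?_) k hk
    change br ⁅x, v⁆ y ∈ S
    rw [h.br_lie_left, hy x hx, map_zero, sub_zero]
    exact lie_mem_left F g0 S _ _ hx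
  obtain ⟨R, hR⟩ := h.exists_isCompl S
  have hSR : ∀ x ∈ S, ∀ r ∈ R, ⁅r, x⁆ = 0 := fun x hx r hr => by
    simpa using hR.1.le_bot ⟨S.lie_mem hx, lie_mem_left F g0 R r x hr⟩
  have hRX : ∀ r ∈ R, r ∈ l0 → ∀ k ∈ X, ⁅r, k⁆ = 0 := fun r hr hrl k hk => by
    refine X_induction (LinearMap.ker (LieModule.toEnd F g0 g1 r)) (fun x hx v => ?_) k hk
    change ⁅r, ⁅x, v⁆⁆ = 0
    have hn : ⁅r, ⁅x, v⁆⁆ ∈ X := X.lie_mem (hSX x hx v)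
    have hTn : ∀ t ∈ T, br t ⁅r, ⁅x, v⁆⁆ = 0 := fun t ht => by
      have h1 := h.equiv r t ⁅x, v⁆
      have h2 := h.equiv x t v
      rw [hlT r hrl t ht, map_zero, LinearMap.zero_apply, zero_add] at h1
      rw [hlT x (hSl x hx) t ht, map_zero, LinearMap.zero_apply, zero_add] at h2
      rw [← h1, ← h2]
      exact hSR _ (lie_mem_left F g0 S _ _ hx) r hr
    have hny : ⁅r, ⁅x, v⁆⁆ ∈ Y := fun z hz =>
      h.lie_eq_zero_of_mem_bracketIdeal (fun t ht k hk => by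
        rw [h.lie_br_eq, hTn t ht, hlT _ (hl4 k hk _) t ht]; simp) (hSE hz)
    simpa using hXY.1.le_bot ⟨hn, hny⟩
  obtain ⟨Q, hQ⟩ := h.exists_isCompl hl.1.even
  have hbrXX : ∀ k ∈ X, ∀ k' ∈ X, br k k' ∈ S := fun k hk k' hk' => by
    have htop : br k k' ∈ S ⊔ R := by rw [hR.sup_eq_top]; trivial
    obtain ⟨p, hp, c, hc, hpc⟩ := (LieSubmodule.mem_sup _ _ _).1 htop
    have hceq : c = br k k' - p := by rw [← hpc]; abel
    have hcl : c ∈ l0 := by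
      rw [hceq]; exact sub_mem (hl4 k (hXl hk) k') (hSl p hp)
    have hcR : ∀ r ∈ R, r ∈ l0 → ⁅r, c⁆ = 0 := fun r hr hrl => by
      rw [hceq, lie_sub, hSR p hp r hr, h.equiv, hRX r hr hrl k hk, hRX r hr hrl k' hk']
      simp
    have hcl0 : ∀ a ∈ l0, ⁅a, c⁆ = 0 := fun a ha => by
      have hat : a ∈ S ⊔ R := by rw [hR.sup_eq_top]; trivial
      obtain ⟨s, hs, r, hr, rfl⟩ := (LieSubmodule.mem_sup _ _ _).1 hat
      have hrl : r ∈ l0 := by simpa using sub_mem ha (hSl s hs)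
      rw [add_lie, hcR r hr hrl, ← lie_skew, hSR s hs c hc, neg_zero, add_zero]
    have hcen : ∀ a : g0, ⁅c, a⁆ = 0 := fun a => by
      have hat : a ∈ hl.1.even ⊔ Q := by rw [hQ.sup_eq_top]; trivial
      obtain ⟨s, hs, q, hq, rfl⟩ := (LieSubmodule.mem_sup _ _ _).1 hat
      have hcq : ⁅c, q⁆ = 0 := by
        simpa using hQ.1.le_bot ⟨lie_mem_left F g0 hl.1.even c q hcl, Q.lie_mem hq⟩
      rw [lie_add, hcq, add_zero, ← lie_skew, hcl0 s hs, neg_zero]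
    have hc0 : c = 0 := by
      refine h.center_even c hcen fun v => ?_
      have hv : v ∈ X ⊔ Y := by rw [hXY.sup_eq_top]; trivial
      obtain ⟨a, ha, y, hy, rfl⟩ := (LieSubmodule.mem_sup _ _ _).1 hv
      have hcy : ⁅c, y⁆ ∈ X := by
        rw [hceq, sub_lie, hy p hp, sub_zero, h.lie_br_eq]
        exact sub_mem (neg_mem (hSX _ (hbrXY k' hk' y hy) k)) (hSX _ (hbrXY k hk y hy) k')
      rw [lie_add, hRX c hc hcl a ha, zero_add]
      simpa using hXY.1.le_bot ⟨hcy, Y.lie_mem hy⟩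
    rw [← hpc, hc0, add_zero]
    exact hp
  have hI : IsIdeal br S.toSubmodule X.toSubmodule := by
    refine ⟨fun a x hx => S.lie_mem hx, fun a w hw => X.lie_mem hw, hSX, fun k hk w => ?_⟩
    have hw : w ∈ X ⊔ Y := by rw [hXY.sup_eq_top]; trivial
    obtain ⟨a, ha, y, hy, rfl⟩ := (LieSubmodule.mem_sup _ _ _).1 hw
    rw [map_add]
    exact add_mem (hbrXX k hk a ha) (hbrXY k hk y hy)
  exact hl.2.2 _ _ hI hSl hXl (Or.inl fun hb => hS (by simpa using hb))

/-- An element of `T` acting nontrivially on a minimal ideal `l` maps `l₁` bijectively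
onto `l₀`. -/
theorem br_bijective_of_ne_zero (h : IsCenterlessQuasireductive br)
    {l0 : Submodule F g0} {l1 : Submodule F g1} (hl : IsMinimalIdeal br l0 l1)
    (hlT : ∀ c ∈ l0, ∀ t ∈ T, ⁅c, t⁆ = 0) {u : g1} (hu : u ∈ T)
    (hne : ∃ k ∈ l1, br u k ≠ 0) :
    l1.map (br u) = l0 ∧ ∀ k ∈ l1, br u k = 0 → k = 0 := by
  obtain ⟨hl1, hl2, hl3, hl4⟩ := hl.1
  have hl4' : ∀ v ∈ l1, ∀ w, br w v ∈ l0 := fun v hv w => by rw [h.symm]; exact hl4 v hv w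
  obtain ⟨Q, hQ⟩ := h.exists_isCompl hl.1.even
  let S : LieIdeal F g0 :=
    { l1.map (br u) with
      lie_mem := fun {a x} hx => by
        obtain ⟨k, hk, rfl⟩ := hx
        have hat : a ∈ hl.1.even ⊔ Q := by rw [hQ.sup_eq_top]; trivial
        obtain ⟨s, hs, q, hq, rfl⟩ := (LieSubmodule.mem_sup _ _ _).1 hat
        have hq0 : ⁅q, br u k⁆ = 0 := by
          simpa using hQ.1.le_bot ⟨hl.1.even.lie_mem (hl4' k hk u), lie_mem_left F g0 Q q _ hq⟩
        refine ⟨⁅s, k⁆, hl2 s k hk, ?_⟩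
        rw [add_lie, hq0, add_zero, h.equiv, hlT s hs u hu]
        simp }
  have hS : S ≠ ⊥ := fun hb => by
    obtain ⟨k, hk, hk0⟩ := hne
    have : br u k ∈ S := ⟨k, hk, rfl⟩
    rw [hb] at this
    exact hk0 (by simpa using this)
  have hSE : S ≤ h.bracketIdeal T hl.1.odd := by
    rintro _ ⟨k, hk, rfl⟩
    exact h.br_mem_bracketIdeal hu hk
  obtain ⟨h0, h1⟩ := h.eq_even_and_lie_top_eq_odd hl hlT hS hSE
  refine ⟨h0, fun n hn hn0 => ?_⟩
  have hnX : n ∈ ⁅S, (⊤ : LieSubmodule F g0 g1)⁆.toSubmodule := by rw [h1]; exact hn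
  have hnY : n ∈ idealInvariants (F := F) S := by
    rintro _ ⟨k, hk, rfl⟩
    rw [h.lie_br_eq, hn0, hlT _ (hl4 k hk n) u hu]
    simp
  simpa using (isCompl_lie_top_idealInvariants h.ss S).1.le_bot ⟨hnX, hnY⟩

/-- Any two elements of `T` act proportionally on a minimal ideal. -/
theorem exists_br_eq_smul (h : IsCenterlessQuasireductive br)
    {l0 : Submodule F g0} {l1 : Submodule F g1} (hl : IsMinimalIdeal br l0 l1)
    (hlT : ∀ c ∈ l0, ∀ t ∈ T, ⁅c, t⁆ = 0) {u s : g1} (hu : u ∈ T) (hs : s ∈ T)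
    (hne : ∃ k ∈ l1, br u k ≠ 0) :
    ∃ μ : F, ∀ k ∈ l1, br s k = μ • br u k := by
  obtain ⟨hmap, hinj⟩ := h.br_bijective_of_ne_zero hl hlT hu hne
  have hmem : ∀ w, ∀ k ∈ l1, br w k ∈ l0 := fun w k hk => by
    rw [h.symm]; exact hl.1.2.2.2 k hk w
  let φ : g1 → l1 →ₗ[F] l0 := fun w => (br w).restrict (hmem w)
  have hφ : Function.Bijective (φ u) := by
    refine ⟨(injective_iff_map_eq_zero _).2 fun k hk =>
      Subtype.ext (hinj k k.2 (congrArg Subtype.val hk)), fun ⟨x, hx⟩ => ?_⟩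
    rw [← hmap] at hx
    obtain ⟨k, hk, rfl⟩ := hx
    exact ⟨⟨k, hk⟩, rfl⟩
  let e := LinearEquiv.ofBijective (φ u) hφ
  obtain ⟨k₀, hk₀, hk₀'⟩ := hne
  have : Nontrivial l1 := ⟨⟨⟨k₀, hk₀⟩, 0, fun hk => hk₀' (by
    rw [show k₀ = 0 from congrArg Subtype.val hk, map_zero])⟩⟩
  obtain ⟨μ, hμ⟩ := Module.End.exists_eigenvalue (e.symm.toLinearMap ∘ₗ φ s)
  obtain ⟨k, hk⟩ := hμ.exists_hasEigenvector
  have hk1 : φ s k = μ • φ u k := by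
    have := congrArg e hk.apply_eq_smul
    simpa [e] using this
  have hk2 : br s k = μ • br u k := congrArg Subtype.val hk1
  refine ⟨μ, ?_⟩
  by_contra! hcon
  obtain ⟨j, hj, hj'⟩ := hcon
  have hinj' := (h.br_bijective_of_ne_zero hl hlT (sub_mem hs (T.smul_mem μ hu))
    ⟨j, hj, by simpa [sub_eq_zero] using hj'⟩).2
  exact hk.2 (Subtype.ext (hinj' k k.2 (by simp [hk2])))

/-- Commutators in `g0` act trivially on any complement of the odd part of `C(g)`. -/
theorem lie_lie_eq_zero (h : IsCenterlessQuasireductive br)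
    (hT : IsCompl T.toSubmodule (COdd br)) (a b : g0) {t : g1} (ht : t ∈ T) :
    ⁅⁅a, b⁆, t⁆ = 0 := by
  refine h.eq_zero_of_mem_centralizerOdd hT.1 (T.lie_mem ht) ⟨fun c hc =>
    lie_eq_zero_of_mem_CEven hT.1 hc (T.lie_mem ht), ?_⟩
  suffices hle : COdd br ≤ LinearMap.ker (br ⁅⁅a, b⁆, t⁆) from fun w hw => hle hw
  refine sSup_le fun l1 ⟨l0, hl⟩ k hk => ?_
  change br ⁅⁅a, b⁆, t⁆ k = 0
  have hlT : ∀ c ∈ l0, ∀ t ∈ T, ⁅c, t⁆ = 0 := fun c hc t ht =>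
    lie_eq_zero_of_mem_CEven hT.1 (hl.even_le_CEven hc) ht
  have hann : ∀ (x : g0) (s : g1), (∀ k ∈ l1, br s k = 0) → ∀ k ∈ l1, br ⁅x, s⁆ k = 0 :=
    fun x s hs k hk => by
      rw [h.br_lie_left, hs k hk, hs _ (hl.1.2.1 x k hk), lie_zero, sub_zero]
  by_cases hne : ∃ k ∈ l1, br t k ≠ 0
  · obtain ⟨μ, hμ⟩ := h.exists_br_eq_smul hl hlT ht (T.lie_mem (x := a) ht) hne
    obtain ⟨ν, hν⟩ := h.exists_br_eq_smul hl hlT ht (T.lie_mem (x := b) ht) hne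
    have h1 := hann a (⁅b, t⁆ - ν • t) (fun k hk => by simp [hν k hk]) k hk
    have h2 := hann b (⁅a, t⁆ - μ • t) (fun k hk => by simp [hμ k hk]) k hk
    simp only [lie_sub, lie_smul, map_sub, map_smul, LinearMap.sub_apply,
      LinearMap.smul_apply, sub_eq_zero] at h1 h2
    rw [lie_lie, map_sub, LinearMap.sub_apply, h1, h2, hμ k hk, hν k hk, smul_comm, sub_self]
  · push Not at hne
    rw [lie_lie, map_sub, LinearMap.sub_apply, hann a _ (hann b t hne) k hk,
      hann b _ (hann a t hne) k hk, sub_zero]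

end IsCenterlessQuasireductive

theorem stmt9
    (br : g1 →ₗ[F] g1 →ₗ[F] g0)
    (hsymm : ∀ v w : g1, br v w = br w v)
    (hequiv : ∀ (a : g0) (v w : g1), ⁅a, br v w⁆ = br ⁅a, v⁆ w + br v ⁅a, w⁆)
    (hjac : ∀ u v w : g1, ⁅br u v, w⁆ + ⁅br v w, u⁆ + ⁅br w u, v⁆ = 0)
    (hred : LieAlgebra.radical F g0 = LieAlgebra.center F g0)
    (hss : ∀ N : LieSubmodule F g0 g1, ∃ N', IsCompl N N')
    (hZ0 : ∀ x : g0, (∀ a : g0, ⁅x, a⁆ = 0) → (∀ v : g1, ⁅x, v⁆ = 0) → x = 0)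
    (hZ1 : ∀ v : g1, (∀ a : g0, ⁅a, v⁆ = 0) → (∀ w : g1, br v w = 0) → v = 0) :
    ∃ (r0 : Submodule F g0) (r1 : Submodule F g1),
      IsCompl r0 (CEven br) ∧ IsCompl r1 (COdd br) ∧
      (∀ a ∈ r0, ∀ b ∈ r0, ⁅a, b⁆ ∈ r0) ∧
      (∀ a ∈ r0, ∀ v ∈ r1, ⁅a, v⁆ ∈ r1) ∧
      (∀ v ∈ r1, ∀ w ∈ r1, br v w ∈ r0) ∧
      (∀ v ∈ r1, ∀ w ∈ r1, br v w = 0) ∧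
      (∀ x ∈ Submodule.span F {y : g0 | ∃ a ∈ r0, ∃ b ∈ r0, y = ⁅a, b⁆},
        ∀ v ∈ r1, ⁅x, v⁆ = (0 : g1)) := by
  have h : IsCenterlessQuasireductive br := ⟨hsymm, hequiv, hjac, hred, hss, hZ0, hZ1⟩
  have hC := isIdeal_CEven_COdd br
  obtain ⟨R, hR⟩ := h.exists_isCompl hC.even
  obtain ⟨T, hT⟩ := hss hC.odd
  have hR' : IsCompl R.toSubmodule (CEven br) :=
    (LieSubmodule.isCompl_toSubmodule.2 hR).symm
  have hT' : IsCompl T.toSubmodule (COdd br) :=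
    (LieSubmodule.isCompl_toSubmodule.2 hT).symm
  refine ⟨R.toSubmodule, T.toSubmodule, hR', hT', fun a _ b hb => R.lie_mem hb,
    fun a _ v hv => T.lie_mem hv, fun v hv w hw => ?_,
    fun v hv w hw => h.br_eq_zero_of_isCompl hT' hv hw, fun x hx v hv => ?_⟩
  · rw [h.br_eq_zero_of_isCompl hT' hv hw]
    exact zero_mem _
  · refine Submodule.span_le (p := LinearMap.ker
      ((LieModule.toEnd F g0 g1 : g0 →ₗ[F] Module.End F g1).flip v)).2 ?_ hx
    rintro _ ⟨a, _, b, _, rfl⟩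
    exact h.lie_lie_eq_zero hT' a b hv
end

section
/- Let g be a quasireductive finite-dimensional Lie superalgebra over F. Then the Loewy length of the adjoint module is at most 3: there exist ideals i ⊆ j of g (componentwise inclusion) such that i equals the sum of all minimal ideals of g, the image of j in the quotient Lie superalgebra g/i equals the sum of all minimal ideals of g/i, and the quotient Lie superalgebra g/j equals the sum of all of its own minimal ideals (each of these sums being the whole space when the corresponding algebra is zero). -/
/- STATEMENT 10: the Loewy length of the adjoint module of a quasireductive finite-dimensional
Lie superalgebra is at most 3: there is a chain of ideals ⊥ ⊆ i ⊆ j ⊆ g such that i is the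
socle of g, j/i is the socle of g/i, and g/j equals the sum of its own minimal ideals.
Minimal ideals of a quotient g/i are encoded via ideals of g that are minimal over i. -/

variable {F : Type} [Field F] [IsAlgClosed F] [CharZero F]
variable {g0 : Type} [LieRing g0] [LieAlgebra F g0] [FiniteDimensional F g0]
variable {g1 : Type} [AddCommGroup g1] [Module F g1] [FiniteDimensional F g1]
variable [LieRingModule g0 g1] [LieModule F g0 g1]

/-- `(m0, m1)` is an ideal of g which is minimal among ideals strictly containing `(i0, i1)`;
under the correspondence between ideals of g/i and ideals of g containing i, these are
exactly the minimal ideals of the quotient Lie superalgebra g/i. -/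
def MinimalOver (br : g1 →ₗ[F] g1 →ₗ[F] g0)
    (i0 : Submodule F g0) (i1 : Submodule F g1)
    (m0 : Submodule F g0) (m1 : Submodule F g1) : Prop :=
  IsIdeal br m0 m1 ∧ i0 ≤ m0 ∧ i1 ≤ m1 ∧ ¬(m0 = i0 ∧ m1 = i1) ∧
  ∀ p0 : Submodule F g0, ∀ p1 : Submodule F g1,
    IsIdeal br p0 p1 → i0 ≤ p0 → i1 ≤ p1 → p0 ≤ m0 → p1 ≤ m1 →
    (p0 = i0 ∧ p1 = i1) ∨ (p0 = m0 ∧ p1 = m1)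

/-- Even part of the preimage in g of the sum of all minimal ideals of g/i. -/
noncomputable def socEven (br : g1 →ₗ[F] g1 →ₗ[F] g0)
    (i0 : Submodule F g0) (i1 : Submodule F g1) : Submodule F g0 :=
  i0 ⊔ sSup {m0 : Submodule F g0 | ∃ m1 : Submodule F g1, MinimalOver br i0 i1 m0 m1}

/-- Odd part of the preimage in g of the sum of all minimal ideals of g/i. -/
noncomputable def socOdd (br : g1 →ₗ[F] g1 →ₗ[F] g0)
    (i0 : Submodule F g0) (i1 : Submodule F g1) : Submodule F g1 :=
  i1 ⊔ sSup {m1 : Submodule F g1 | ∃ m0 : Submodule F g0, MinimalOver br i0 i1 m0 m1}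

set_option linter.unusedSectionVars false

section ReductiveComplement

variable {k L : Type*} [Field k] [CharZero k] [LieRing L] [LieAlgebra k L] [FiniteDimensional k L]

open LieAlgebra LieModule

/-- The projection of a Lie algebra onto its quotient by an ideal, as a morphism of Lie algebras. -/
def LieIdeal.quotientHom (I : LieIdeal k L) : L →ₗ⁅k⁆ L ⧸ I :=
  { LieSubmodule.Quotient.mk' I with map_lie' := rfl }

theorem LieIdeal.quotientHom_eq_zero (I : LieIdeal k L) (x : L) : I.quotientHom x = 0 ↔ x ∈ I :=
  LieSubmodule.Quotient.mk_eq_zero'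

theorem LieIdeal.quotientHom_surjective (I : LieIdeal k L) : Function.Surjective I.quotientHom :=
  LieSubmodule.Quotient.surjective_mk' I

theorem LieAlgebra.hasTrivialRadical_quotient_center (h : radical k L = center k L) :
    HasTrivialRadical k (L ⧸ center k L) := by
  rw [hasTrivialRadical_iff_no_abelian_ideals]
  intro A hA
  let π := (center k L).quotientHom
  have hπ : ∀ x, π x = 0 ↔ x ∈ center k L := (center k L).quotientHom_eq_zero
  let I : LieIdeal k L := A.comap π
  have hI : IsSolvable I := by
    refine IsSolvable.mk (R := k) (k := 2) ?_
    have hc : ∀ x y : I, ∀ z : I, ⁅⁅x, y⁆, z⁆ = 0 := by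
      intro x y z
      have h0 : ⁅π x, π y⁆ = 0 := by
        have := hA.trivial ⟨π x, (LieIdeal.mem_comap).1 x.2⟩ ⟨π y, (LieIdeal.mem_comap).1 y.2⟩
        simpa using congrArg Subtype.val this
      rw [← LieHom.map_lie, hπ, LieModule.mem_maxTrivSubmodule] at h0
      apply Subtype.ext
      change ⁅⁅(x : L), (y : L)⁆, (z : L)⁆ = 0
      rw [← lie_skew, h0, neg_zero]
    have hle : (⁅(⊤ : LieIdeal k I), (⊤ : LieIdeal k I)⁆ : LieIdeal k I) ≤ center k I := by
      rw [LieSubmodule.lie_le_iff]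
      intro x _ y _
      rw [LieModule.mem_maxTrivSubmodule]
      intro z
      rw [← lie_skew, hc, neg_zero]
    simp only [derivedSeriesOfIdeal_succ, derivedSeriesOfIdeal_zero]
    rw [LieSubmodule.lie_eq_bot_iff]
    intro x _ m hm
    exact (LieModule.mem_maxTrivSubmodule _ _ _ _).1 (hle hm) x
  have hle : I ≤ center k L := h ▸ (LieIdeal.solvable_iff_le_radical k L I).1 hI
  rw [eq_bot_iff]
  intro a ha
  obtain ⟨x, rfl⟩ := LieSubmodule.Quotient.surjective_mk' (center k L) a
  exact (hπ x).2 (hle ha)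

/-- The commutator ideal of a reductive Lie algebra meets the centre trivially. -/
theorem LieAlgebra.disjoint_derived_center (h : radical k L = center k L) :
    Disjoint ⁅(⊤ : LieIdeal k L), (⊤ : LieIdeal k L)⁆ (center k L) := by
  have := hasTrivialRadical_quotient_center h
  set Z := center k L with hZ
  let π : L →ₗ[k] L ⧸ Z := LieSubmodule.Quotient.mk' Z
  have hπl : ∀ x y, π ⁅x, y⁆ = ⁅π x, π y⁆ := fun _ _ => rfl
  have hπ0 : ∀ x, π x = 0 ↔ x ∈ Z := fun x => LieSubmodule.Quotient.mk_eq_zero'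
  have hπs : Function.Surjective π := LieSubmodule.Quotient.surjective_mk' Z
  obtain ⟨σ, hσ⟩ := π.exists_rightInverse_of_surjective (LinearMap.range_eq_top.2 hπs)
  have hσ' : ∀ a, π (σ a) = a := fun a => LinearMap.congr_fun hσ a
  have key : ∀ f : L →ₗ[k] k, ∃ d : L ⧸ Z, ∀ x y : L,
      f ⁅x, y⁆ = killingForm k (L ⧸ Z) d (π ⁅x, y⁆) := by
    intro f
    let ω : (L ⧸ Z) →ₗ[k] (L ⧸ Z) →ₗ[k] k :=
      ((LieModule.toEnd k L L : L →ₗ[k] Module.End k L).compr₂ f).compl₁₂ σ σ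
    have hω : ∀ x y, f ⁅x, y⁆ = ω (π x) (π y) := by
      intro x y
      have hx : σ (π x) - x ∈ Z := by rw [← hπ0, map_sub, hσ', sub_self]
      have hy : σ (π y) - y ∈ Z := by rw [← hπ0, map_sub, hσ', sub_self]
      have e1 := (LieModule.mem_maxTrivSubmodule _ _ _ _).1 hy (σ (π x))
      have e2 := (LieModule.mem_maxTrivSubmodule _ _ _ _).1 hx y
      rw [← lie_skew, neg_eq_zero] at e2
      rw [lie_sub, sub_eq_zero] at e1
      rw [sub_lie, sub_eq_zero] at e2
      change _ = f ⁅σ (π x), σ (π y)⁆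
      rw [e1, e2]
    have hnd := LieAlgebra.IsKilling.killingForm_nondegenerate k (L ⧸ Z)
    let D : (L ⧸ Z) →ₗ[k] (L ⧸ Z) :=
      ((LinearMap.BilinForm.toDual (killingForm k (L ⧸ Z)) hnd).symm : _ →ₗ[k] _) ∘ₗ ω
    have hD : ∀ a b, killingForm k (L ⧸ Z) (D a) b = ω a b := fun a b =>
      LinearMap.BilinForm.apply_toDual_symm_apply (hB := hnd) _ _
    have hinv : ∀ a b c : L ⧸ Z,
        killingForm k (L ⧸ Z) ⁅a, b⁆ c = - killingForm k (L ⧸ Z) b ⁅a, c⁆ := by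
      intro a b c
      rw [← lie_skew, map_neg, LinearMap.neg_apply, LieModule.traceForm_apply_lie_apply]
    let δ : LieDerivation k (L ⧸ Z) (L ⧸ Z) :=
      { D with
        leibniz' := by
          intro a b
          change D ⁅a, b⁆ = ⁅a, D b⁆ - ⁅b, D a⁆
          apply LinearMap.ker_eq_bot.1 (LinearMap.BilinForm.nondegenerate_iff_ker_eq_bot.1 hnd)
          ext c
          obtain ⟨x, rfl⟩ := hπs a
          obtain ⟨y, rfl⟩ := hπs b
          obtain ⟨z, rfl⟩ := hπs c
          simp only [map_sub, LinearMap.sub_apply, hinv, hD, ← hπl, ← hω]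
          rw [lie_lie, map_sub]
          ring }
    obtain ⟨d, hd⟩ := LieDerivation.IsKilling.exists_eq_ad δ
    have hd' : ∀ a, ⁅d, a⁆ = D a := fun a => by
      have h : _ = D a := DFunLike.congr_fun hd a
      simpa using h
    refine ⟨d, fun x y => ?_⟩
    rw [hω, ← hD, ← hd', hπl, LieModule.traceForm_apply_lie_apply]
  rw [disjoint_iff, eq_bot_iff]
  rintro z ⟨hz1, hz2⟩
  rw [LieSubmodule.mem_bot]
  by_contra hne
  obtain ⟨f, hf⟩ : ∃ f : L →ₗ[k] k, f z ≠ 0 := by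
    by_contra! hc
    exact hne ((Module.forall_dual_apply_eq_zero_iff k z).1 hc)
  obtain ⟨d, hd⟩ := key f
  apply hf
  have hz : z ∈ LinearMap.ker (f - killingForm k (L ⧸ Z) d ∘ₗ π) := by
    have hle : (⁅(⊤ : LieIdeal k L), (⊤ : LieIdeal k L)⁆ : LieIdeal k L).toSubmodule ≤
        LinearMap.ker (f - killingForm k (L ⧸ Z) d ∘ₗ π) := by
      rw [LieSubmodule.lieIdeal_oper_eq_linear_span', Submodule.span_le]
      rintro _ ⟨x, _, y, _, rfl⟩
      simp [hd]
    exact hle hz1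
  simp only [LinearMap.mem_ker, LinearMap.sub_apply, LinearMap.comp_apply, (hπ0 z).2 hz2, map_zero,
    sub_zero] at hz
  exact hz

theorem LieAlgebra.exists_isCompl_of_radical_eq_center (h : radical k L = center k L)
    (I : LieIdeal k L) : ∃ J : LieIdeal k L, IsCompl I J := by
  have := hasTrivialRadical_quotient_center h
  have hdis := disjoint_derived_center h
  set Z := center k L with hZ
  let π := Z.quotientHom
  have hπ0 : ∀ x, π x = 0 ↔ x ∈ Z := Z.quotientHom_eq_zero
  have hπs : Function.Surjective π := Z.quotientHom_surjective
  have hmap : ∀ (A : LieIdeal k L) (a : L ⧸ Z), a ∈ LieIdeal.map π A → ∃ x ∈ A, π x = a := by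
    intro A a ha
    have := LieIdeal.coe_map_of_surjective (I := A) hπs
    rw [← LieSubmodule.mem_toSubmodule, this] at ha
    exact ha
  have hperf : ⁅(⊤ : LieIdeal k (L ⧸ Z)), (⊤ : LieIdeal k (L ⧸ Z))⁆ = ⊤ := by
    obtain ⟨J, hJ⟩ := exists_isCompl ⁅(⊤ : LieIdeal k (L ⧸ Z)), (⊤ : LieIdeal k (L ⧸ Z))⁆
    have hJ0 : J = ⊥ := by
      rw [eq_bot_iff, ← LieAlgebra.center_eq_bot k (L ⧸ Z)]
      intro x hx
      rw [LieModule.mem_maxTrivSubmodule]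
      intro y
      exact (LieSubmodule.mem_bot _).1 (hJ.disjoint.le_bot
        ⟨LieSubmodule.lie_mem_lie trivial trivial, J.lie_mem hx⟩)
    simpa [hJ0] using hJ.sup_eq_top
  set L' := ⁅(⊤ : LieIdeal k L), (⊤ : LieIdeal k L)⁆ with hL'
  have hlift : ∀ a, ∃ x ∈ L', π x = a := by
    intro a
    apply hmap
    have htop : LieIdeal.map π ⊤ = ⊤ := by
      rw [eq_top_iff]
      intro b _
      obtain ⟨x, rfl⟩ := hπs b
      exact LieIdeal.mem_map trivial
    rw [hL', LieIdeal.map_bracket_eq _ hπs, htop, hperf]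
    trivial
  obtain ⟨B, hB⟩ := exists_isCompl (LieIdeal.map π I)
  obtain ⟨C, hC⟩ := exists_isCompl ((I ⊓ Z).toSubmodule)
  let C' : LieIdeal k L :=
    { C ⊓ Z.toSubmodule with
      lie_mem := by
        rintro x m ⟨_, hm⟩
        have h0 : ⁅x, m⁆ = 0 := (LieModule.mem_maxTrivSubmodule _ _ _ _).1 hm x
        rw [h0]
        exact zero_mem (C ⊓ Z.toSubmodule) }
  have hZ' : ∀ z ∈ Z, ∃ z₁ ∈ I, ∃ z₂ ∈ C', z₁ + z₂ = z := by
    intro z hz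
    have : z ∈ (I ⊓ Z).toSubmodule ⊔ C := hC.sup_eq_top ▸ Submodule.mem_top
    obtain ⟨z₁, h₁, z₂, h₂, rfl⟩ := Submodule.mem_sup.1 this
    refine ⟨z₁, h₁.1, z₂, ⟨h₂, ?_⟩, rfl⟩
    have := sub_mem hz h₁.2
    rwa [add_sub_cancel_left] at this
  refine ⟨(B.comap π ⊓ L') ⊔ C', ?_, ?_⟩
  · rw [disjoint_iff, eq_bot_iff]
    rintro y ⟨hy, hy'⟩
    obtain ⟨x, ⟨hx1, hx2⟩, z, ⟨hz1, hz2⟩, rfl⟩ := (LieSubmodule.mem_sup _ _ _).1 hy'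
    have hz0 : π z = 0 := (hπ0 z).2 hz2
    have hx0 : π x ∈ LieIdeal.map π I ⊓ B := by
      refine ⟨?_, hx1⟩
      have := LieIdeal.mem_map (f := π) hy
      rwa [map_add, hz0, add_zero] at this
    rw [hB.inf_eq_bot, LieSubmodule.mem_bot, hπ0] at hx0
    have hx : x = 0 := (LieSubmodule.mem_bot _).1 (hdis.le_bot ⟨hx2, hx0⟩)
    subst hx
    rw [zero_add] at hy ⊢
    have : z ∈ (I ⊓ Z).toSubmodule ⊓ C := ⟨⟨hy, hz2⟩, hz1⟩
    rw [hC.inf_eq_bot] at this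
    exact this
  · rw [codisjoint_iff, eq_top_iff]
    intro y _
    have : π y ∈ LieIdeal.map π I ⊔ B := hB.sup_eq_top ▸ trivial
    obtain ⟨a, ha, b, hb, hab⟩ := (LieSubmodule.mem_sup _ _ _).1 this
    obtain ⟨i, hi, rfl⟩ := hmap I a ha
    obtain ⟨t, ht, rfl⟩ := hlift b
    have hz : y - (i + t) ∈ Z := by rw [← hπ0, map_sub, map_add, hab, sub_self]
    obtain ⟨z₁, h₁, z₂, h₂, h12⟩ := hZ' _ hz
    have hy : y = (i + z₁) + (t + z₂) := by
      rw [add_add_add_comm, h12]; abel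
    rw [hy]
    refine add_mem (le_sup_left (a := I) (add_mem hi h₁)) (le_sup_right (a := I) (add_mem ?_ ?_))
    · exact le_sup_left (a := B.comap π ⊓ L') ⟨hb, ht⟩
    · exact le_sup_right (b := C') h₂

end ReductiveComplement
theorem LieSubmodule.lie_toSubmodule_le {I : LieIdeal F g0} {N : LieSubmodule F g0 g1}
    {p : Submodule F g1} (h : ∀ x ∈ I, ∀ v ∈ N, ⁅x, v⁆ ∈ p) : (⁅I, N⁆).toSubmodule ≤ p := by
  rw [LieSubmodule.lieIdeal_oper_eq_linear_span', Submodule.span_le]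
  rintro _ ⟨x, hx, v, hv, rfl⟩
  exact h x hx v hv

variable (g1) in
/-- The Lie submodule of vectors annihilated by an ideal. -/
def LieIdeal.fixed (I : LieIdeal F g0) : LieSubmodule F g0 g1 where
  carrier := {v | ∀ x ∈ I, ⁅x, v⁆ = 0}
  zero_mem' := fun x _ => lie_zero x
  add_mem' := fun ha hb x hx => by rw [lie_add, ha x hx, hb x hx, add_zero]
  smul_mem' := fun c v hv x hx => by rw [lie_smul, hv x hx, smul_zero]
  lie_mem := by
    intro a v hv x hx
    rw [leibniz_lie, hv x hx, lie_zero, add_zero]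
    exact hv _ (lie_mem_left F g0 I x a hx)

theorem exists_disjoint_le_sup {α : Type*} [Lattice α] [BoundedOrder α] [IsModularLattice α]
    (h : ∀ x : α, ∃ y, IsCompl x y) (a b : α) : ∃ d ≤ a, Disjoint d b ∧ a ≤ b ⊔ d := by
  obtain ⟨c, hc⟩ := h (a ⊓ b)
  refine ⟨a ⊓ c, inf_le_left, ?_, ?_⟩
  · rw [disjoint_iff, inf_right_comm, hc.inf_eq_bot]
  · calc a = (a ⊓ b ⊔ c) ⊓ a := by rw [hc.sup_eq_top, top_inf_eq]
      _ = a ⊓ b ⊔ c ⊓ a := sup_inf_assoc_of_le _ inf_le_left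
      _ ≤ b ⊔ a ⊓ c := sup_le_sup inf_le_right (inf_comm c a).le

theorem LieIdeal.disjoint_lie_top_fixed (hss : ∀ N : LieSubmodule F g0 g1, ∃ N', IsCompl N N')
    (I : LieIdeal F g0) :
    Disjoint ⁅I, (⊤ : LieSubmodule F g0 g1)⁆ (I.fixed g1) := by
  obtain ⟨W, hW⟩ := hss (I.fixed g1)
  refine hW.disjoint.symm.mono_left ?_
  rw [← hW.sup_eq_top, LieSubmodule.lie_sup]
  refine sup_le ?_ (LieSubmodule.lie_le_right _ _)
  rw [LieSubmodule.lie_le_iff]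
  intro x hx v hv
  rw [hv x hx]
  exact zero_mem W

theorem LieIdeal.lie_top_sup_fixed (hss : ∀ N : LieSubmodule F g0 g1, ∃ N', IsCompl N N')
    (I : LieIdeal F g0) :
    ⁅I, (⊤ : LieSubmodule F g0 g1)⁆ ⊔ I.fixed g1 = ⊤ := by
  obtain ⟨W, hW⟩ := hss ⁅I, (⊤ : LieSubmodule F g0 g1)⁆
  refine eq_top_iff.2 (hW.sup_eq_top.symm.le.trans ?_)
  refine sup_le_sup_left (fun v hv x hx => ?_) _
  exact (LieSubmodule.mem_bot _).1 (hW.disjoint.le_bot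
    ⟨LieSubmodule.lie_mem_lie hx trivial, W.lie_mem hv⟩)

theorem LieIdeal.exists_add_fixed (hss : ∀ N : LieSubmodule F g0 g1, ∃ N', IsCompl N N')
    (I : LieIdeal F g0) (v : g1) :
    ∃ h ∈ ⁅I, (⊤ : LieSubmodule F g0 g1)⁆, ∃ g ∈ I.fixed g1, h + g = v :=
  (LieSubmodule.mem_sup _ _ _).1 ((I.lie_top_sup_fixed hss).symm ▸ LieSubmodule.mem_top v)

theorem LieIdeal.lie_eq_zero_of_disjoint {I J : LieIdeal F g0} (h : Disjoint I J) {x y : g0}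
    (hx : x ∈ I) (hy : y ∈ J) : ⁅x, y⁆ = 0 :=
  (LieSubmodule.mem_bot _).1 (h.le_bot ⟨lie_mem_left F g0 I x y hx, J.lie_mem hy⟩)

/-- The axioms making `(g0, g1, br)` a Lie superalgebra. -/
structure IsSuperBracket (br : g1 →ₗ[F] g1 →ₗ[F] g0) : Prop where
  symm : ∀ v w : g1, br v w = br w v
  equiv : ∀ (a : g0) (v w : g1), ⁅a, br v w⁆ = br ⁅a, v⁆ w + br v ⁅a, w⁆
  jac : ∀ u v w : g1, ⁅br u v, w⁆ + ⁅br v w, u⁆ + ⁅br w u, v⁆ = 0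

variable {br : g1 →ₗ[F] g1 →ₗ[F] g0}

theorem isIdeal_iff {I : LieIdeal F g0} {N : LieSubmodule F g0 g1} :
    IsIdeal br I.toSubmodule N.toSubmodule ↔
      (∀ x ∈ I, ∀ v : g1, ⁅x, v⁆ ∈ N) ∧ ∀ v ∈ N, ∀ w : g1, br v w ∈ I :=
  ⟨fun h => ⟨h.2.2.1, h.2.2.2⟩,
    fun h => ⟨fun _ _ hx => I.lie_mem hx, fun _ _ hv => N.lie_mem hv, h.1, h.2⟩⟩

theorem IsIdeal.exists_lie {l0 : Submodule F g0} {l1 : Submodule F g1} (h : IsIdeal br l0 l1) :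
    ∃ (I : LieIdeal F g0) (N : LieSubmodule F g0 g1), I.toSubmodule = l0 ∧ N.toSubmodule = l1 :=
  ⟨{ l0 with lie_mem := fun {a x} hx => h.1 a x hx },
    { l1 with lie_mem := fun {a v} hv => h.2.1 a v hv }, rfl, rfl⟩

theorem isIdeal_bot : IsIdeal br ⊥ ⊥ := by
  simp [IsIdeal]

section Socle

variable {i0 : Submodule F g0} {i1 : Submodule F g1}

theorem MinimalOver.le_soc {m0 : Submodule F g0} {m1 : Submodule F g1}
    (h : MinimalOver br i0 i1 m0 m1) : m0 ≤ socEven br i0 i1 ∧ m1 ≤ socOdd br i0 i1 :=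
  ⟨le_sup_of_le_right (le_sSup ⟨m1, h⟩), le_sup_of_le_right (le_sSup ⟨m0, h⟩)⟩

theorem IsIdeal.soc (hi : IsIdeal br i0 i1) :
    IsIdeal br (socEven br i0 i1) (socOdd br i0 i1) := by
  have h0 : ∀ {p : Submodule F g0}, i0 ≤ p →
      (∀ m0 m1, MinimalOver br i0 i1 m0 m1 → m0 ≤ p) → socEven br i0 i1 ≤ p :=
    fun h h' => sup_le h (sSup_le fun m0 ⟨m1, hm⟩ => h' m0 m1 hm)
  have h1 : ∀ {p : Submodule F g1}, i1 ≤ p →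
      (∀ m0 m1, MinimalOver br i0 i1 m0 m1 → m1 ≤ p) → socOdd br i0 i1 ≤ p :=
    fun h h' => sup_le h (sSup_le fun m1 ⟨m0, hm⟩ => h' m0 m1 hm)
  have l0 : i0 ≤ socEven br i0 i1 := le_sup_left
  have l1 : i1 ≤ socOdd br i0 i1 := le_sup_left
  refine ⟨fun a => ?_, fun a => ?_, fun x hx v => ?_, fun v hv w => ?_⟩
  · exact h0 (p := (socEven br i0 i1).comap (LieModule.toEnd F g0 g0 a))
      (fun x hx => l0 (hi.1 a x hx)) fun m0 m1 hm x hx => hm.le_soc.1 (hm.1.1 a x hx)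
  · exact h1 (p := (socOdd br i0 i1).comap (LieModule.toEnd F g0 g1 a))
      (fun x hx => l1 (hi.2.1 a x hx)) fun m0 m1 hm x hx => hm.le_soc.2 (hm.1.2.1 a x hx)
  · exact h0 (p := (socOdd br i0 i1).comap
      ((LieModule.toEnd F g0 g1 : g0 →ₗ[F] Module.End F g1).flip v))
      (fun x hx => l1 (hi.2.2.1 x hx v))
      (fun m0 m1 hm x hx => hm.le_soc.2 (hm.1.2.2.1 x hx v)) hx
  · exact h1 (p := (socEven br i0 i1).comap (br.flip w))
      (fun x hx => l0 (hi.2.2.2 x hx w))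
      (fun m0 m1 hm x hx => hm.le_soc.1 (hm.1.2.2.2 x hx w)) hv

/-- An ideal meeting the socle of the quotient trivially is trivial in the quotient. -/
theorem IsIdeal.eq_of_inf_soc_le {q0 : Submodule F g0} {q1 : Submodule F g1}
    (hq : IsIdeal br q0 q1) (h0 : i0 ≤ q0) (h1 : i1 ≤ q1)
    (hs0 : q0 ⊓ socEven br i0 i1 ≤ i0) (hs1 : q1 ⊓ socOdd br i0 i1 ≤ i1) :
    q0 = i0 ∧ q1 = i1 := by
  by_contra hne
  obtain ⟨⟨m0, m1⟩, ⟨hm, hm0, hm1, hmq0, hmq1, hmne⟩, hmin⟩ :=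
    (wellFounded_lt (α := Submodule F g0 × Submodule F g1)).has_min
      {p | IsIdeal br p.1 p.2 ∧ i0 ≤ p.1 ∧ i1 ≤ p.2 ∧ p.1 ≤ q0 ∧ p.2 ≤ q1 ∧
        ¬(p.1 = i0 ∧ p.2 = i1)} ⟨(q0, q1), hq, h0, h1, le_rfl, le_rfl, hne⟩
  have hmo : MinimalOver br i0 i1 m0 m1 := by
    refine ⟨hm, hm0, hm1, hmne, fun p0 p1 hp hp0 hp1 hpm0 hpm1 => ?_⟩
    by_contra! hcon
    refine hmin (p0, p1) ⟨hp, hp0, hp1, hpm0.trans hmq0, hpm1.trans hmq1,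
      fun h => hcon.1 h.1 h.2⟩ (lt_of_le_of_ne ⟨hpm0, hpm1⟩ fun h => ?_)
    exact hcon.2 (congrArg Prod.fst h) (congrArg Prod.snd h)
  exact hmne ⟨le_antisymm ((le_inf hmq0 hmo.le_soc.1).trans hs0) hm0,
    le_antisymm ((le_inf hmq1 hmo.le_soc.2).trans hs1) hm1⟩

end Socle

namespace IsSuperBracket

/-- The ideal of `g0` spanned by the brackets of two submodules of `g1`. -/
def ideal (hb : IsSuperBracket br) (U V : LieSubmodule F g0 g1) : LieIdeal F g0 where
  toSubmodule := Submodule.map₂ br U.toSubmodule V.toSubmodule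
  lie_mem := by
    intro a x hx
    have hle : Submodule.map₂ br U.toSubmodule V.toSubmodule ≤
        (Submodule.map₂ br U.toSubmodule V.toSubmodule).comap (LieModule.toEnd F g0 g0 a) := by
      rw [Submodule.map₂_le]
      intro u hu v hv
      change ⁅a, br u v⁆ ∈ Submodule.map₂ br U.toSubmodule V.toSubmodule
      rw [hb.equiv]
      exact add_mem (Submodule.apply_mem_map₂ _ (U.lie_mem hu) hv)
        (Submodule.apply_mem_map₂ _ hu (V.lie_mem hv))
    exact hle hx

theorem mem_ideal (hb : IsSuperBracket br) {U V : LieSubmodule F g0 g1} {u v : g1}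
    (hu : u ∈ U) (hv : v ∈ V) :
    br u v ∈ hb.ideal U V :=
  Submodule.apply_mem_map₂ _ hu hv

theorem ideal_toSubmodule_le (hb : IsSuperBracket br) {U V : LieSubmodule F g0 g1}
    {p : Submodule F g0} (h : ∀ u ∈ U, ∀ v ∈ V, br u v ∈ p) : (hb.ideal U V).toSubmodule ≤ p :=
  Submodule.map₂_le.2 h

theorem ideal_le (hb : IsSuperBracket br) {U V : LieSubmodule F g0 g1} {I : LieIdeal F g0}
    (h : ∀ u ∈ U, ∀ v ∈ V, br u v ∈ I) : hb.ideal U V ≤ I :=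
  hb.ideal_toSubmodule_le h

/-- The ideal `[g₁, g₁]` of `g₀`. -/
abbrev derived (hb : IsSuperBracket br) : LieIdeal F g0 := hb.ideal ⊤ ⊤

theorem mem_derived (hb : IsSuperBracket br) (v w : g1) : br v w ∈ hb.derived :=
  hb.mem_ideal trivial trivial

theorem lie_bracket_of_fixed (hb : IsSuperBracket br) {I : LieIdeal F g0} {x : g0} (hx : x ∈ I)
    {u : g1} (hu : u ∈ I.fixed g1) (v : g1) : ⁅x, br u v⁆ = br u ⁅x, v⁆ := by
  rw [hb.equiv, hu x hx, map_zero, LinearMap.zero_apply, zero_add]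

/-- A vector killed by the brackets `⟨v, w⟩` and `⟨w, u⟩` makes the action skew. -/
theorem lie_bracket_swap (hb : IsSuperBracket br) {u v w : g1} (h : ⁅br v w, u⁆ = 0) :
    ⁅br u v, w⁆ = -⁅br u w, v⁆ := by
  have := hb.jac u v w
  rw [h, add_zero, hb.symm w u] at this
  exact eq_neg_of_add_eq_zero_left this

end IsSuperBracket

theorem LieIdeal.exists_add_commuting (hg : ∀ I : LieIdeal F g0, ∃ J, IsCompl I J)
    (I : LieIdeal F g0) (b : g0) : ∃ r ∈ I, ∃ a, (∀ x ∈ I, ⁅a, x⁆ = 0) ∧ r + a = b := by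
  obtain ⟨C, hC⟩ := hg I
  obtain ⟨r, hr, a, ha, rfl⟩ :=
    (LieSubmodule.mem_sup _ _ _).1 (hC.sup_eq_top.symm ▸ LieSubmodule.mem_top b)
  exact ⟨r, hr, a, fun x hx => LieIdeal.lie_eq_zero_of_disjoint hC.disjoint.symm ha hx, rfl⟩

theorem LieIdeal.lie_mem_of_le (hg : ∀ I : LieIdeal F g0, ∃ J, IsCompl I J)
    {I : LieIdeal F g0} {T : Submodule F g0} (hT : T ≤ I.toSubmodule)
    (h : ∀ r ∈ I, ∀ x ∈ T, ⁅r, x⁆ ∈ T) (b : g0) {x : g0} (hx : x ∈ T) : ⁅b, x⁆ ∈ T := by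
  obtain ⟨r, hr, a, ha, rfl⟩ := I.exists_add_commuting hg b
  rw [add_lie, ha x (hT hx), add_zero]
  exact h r hr x hx

theorem exists_mem_map_eq_smul {V V' : Type*} [AddCommGroup V] [Module F V] [AddCommGroup V']
    [Module F V'] [FiniteDimensional F V'] {W : Submodule F V} {φ : V →ₗ[F] V'}
    {α : V →ₗ[F] V} (hα : ∀ w ∈ W, α w ∈ W) (hne : W.map φ ≠ ⊥) :
    ∃ c : F, ∃ h ∈ W, φ h ≠ 0 ∧ φ (α h) = c • φ h := by
  have : Nontrivial (W.map φ) := Submodule.nontrivial_iff_ne_bot.2 hne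
  obtain ⟨σ, hσ⟩ := (φ.submoduleMap W).exists_rightInverse_of_surjective
    (LinearMap.range_eq_top.2 (φ.submoduleMap_surjective W))
  obtain ⟨c, hc⟩ := Module.End.exists_eigenvalue
    (φ.submoduleMap W ∘ₗ α.restrict hα ∘ₗ σ : Module.End F (W.map φ))
  obtain ⟨x, hx, hx0⟩ := hc.exists_hasEigenvector
  have hφ : φ (σ x) = x := congrArg Subtype.val (LinearMap.congr_fun hσ x)
  refine ⟨c, σ x, (σ x).2, ?_, ?_⟩
  · rw [hφ]
    simpa using hx0
  · rw [hφ]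
    exact congrArg Subtype.val (Module.End.mem_eigenspace_iff.1 hx)

theorem IsIdeal.le_of_inf_soc_le {i0 d0 : Submodule F g0} {i1 d1 : Submodule F g1}
    (hq : IsIdeal br (i0 ⊔ d0) (i1 ⊔ d1)) (h0 : d0 ⊓ socEven br i0 i1 ≤ i0)
    (h1 : d1 ⊓ socOdd br i0 i1 ≤ i1) : d0 ≤ i0 ∧ d1 ≤ i1 := by
  have h := hq.eq_of_inf_soc_le le_sup_left le_sup_left
    ((sup_inf_assoc_of_le d0 (le_sup_left : i0 ≤ socEven br i0 i1)).le.trans (sup_le le_rfl h0))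
    ((sup_inf_assoc_of_le d1 (le_sup_left : i1 ≤ socOdd br i0 i1)).le.trans (sup_le le_rfl h1))
  exact ⟨sup_eq_left.1 h.1, sup_eq_left.1 h.2⟩

/-- An ideal meeting the socle trivially vanishes. -/
theorem IsIdeal.eq_bot_of_disjoint_soc {I D : LieIdeal F g0} {I1 N : LieSubmodule F g0 g1}
    (hI : I.toSubmodule = socEven br ⊥ ⊥) (hI1 : I1.toSubmodule = socOdd br ⊥ ⊥)
    (hq : IsIdeal br D.toSubmodule N.toSubmodule) (h0 : Disjoint D I) (h1 : Disjoint N I1) :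
    D = ⊥ := by
  have h := hq.eq_of_inf_soc_le (i0 := ⊥) (i1 := ⊥) bot_le bot_le
    (by rw [← hI]; exact h0.le_bot) (by rw [← hI1]; exact h1.le_bot)
  exact (LieSubmodule.toSubmodule_eq_bot D).1 h.1

theorem LieModule.ker_le_soc (hg : ∀ I : LieIdeal F g0, ∃ J, IsCompl I J) {I : LieIdeal F g0}
    {I1 : LieSubmodule F g0 g1} (hI : I.toSubmodule = socEven br ⊥ ⊥)
    (hI1 : I1.toSubmodule = socOdd br ⊥ ⊥) : LieModule.ker F g0 g1 ≤ I := by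
  obtain ⟨D, hDK, hDI, hK⟩ := exists_disjoint_le_sup hg (LieModule.ker F g0 g1) I
  have hq : IsIdeal br D.toSubmodule (⊥ : LieSubmodule F g0 g1).toSubmodule := by
    refine isIdeal_iff.2 ⟨fun x hx v => ?_, fun v hv w => ?_⟩
    · rw [(LieModule.mem_ker F g0 g1 _).1 (hDK hx) v]
      exact zero_mem _
    · rw [(LieSubmodule.mem_bot v).1 hv, map_zero]
      exact zero_mem _
  rwa [hq.eq_bot_of_disjoint_soc hI hI1 hDI disjoint_bot_left, sup_bot_eq] at hK

namespace IsSuperBracket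

/-- The vectors of `g₁` annihilated by `[g₁, g₁]`. -/
abbrev still (hb : IsSuperBracket br) : LieSubmodule F g0 g1 := hb.derived.fixed g1

/-- The submodule `[[g₁, g₁], g₁]` of `g₁`. -/
abbrev moved (hb : IsSuperBracket br) : LieSubmodule F g0 g1 :=
  ⁅hb.derived, (⊤ : LieSubmodule F g0 g1)⁆

theorem ideal_still_le_ker (hb : IsSuperBracket br) :
    hb.ideal hb.still hb.still ≤ LieModule.ker F g0 g1 := by
  refine hb.ideal_le fun u hu v hv => (LieModule.mem_ker F g0 g1 _).2 fun w => ?_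
  have h := hb.jac u v w
  rwa [hu _ (hb.mem_derived v w), hv _ (hb.mem_derived w u), add_zero, add_zero] at h

theorem derived_le (hb : IsSuperBracket br)
    (hss : ∀ N : LieSubmodule F g0 g1, ∃ N', IsCompl N N') :
    hb.derived ≤ hb.ideal hb.still hb.still ⊔ hb.ideal hb.moved ⊤ := by
  refine hb.ideal_le fun v _ w _ => ?_
  obtain ⟨h, hh, g, hgv, rfl⟩ := hb.derived.exists_add_fixed hss v
  obtain ⟨h', hh', g', hg', rfl⟩ := hb.derived.exists_add_fixed hss w
  have hsum : br (h + g) (h' + g') = br g g' + (br h (h' + g') + br h' g) := by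
    rw [map_add br, LinearMap.add_apply, map_add (br g), hb.symm g h']
    abel
  rw [hsum]
  exact add_mem (LieSubmodule.mem_sup_left (hb.mem_ideal hgv hg'))
    (LieSubmodule.mem_sup_right (add_mem (hb.mem_ideal hh trivial) (hb.mem_ideal hh' trivial)))

theorem moved_le (hb : IsSuperBracket br)
    (hss : ∀ N : LieSubmodule F g0 g1, ∃ N', IsCompl N N') :
    hb.moved ≤ ⁅hb.ideal hb.moved ⊤, (⊤ : LieSubmodule F g0 g1)⁆ := by
  refine (LieSubmodule.mono_lie_left _ (hb.derived_le hss)).trans ?_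
  rw [LieSubmodule.sup_lie]
  refine sup_le ?_ le_rfl
  rw [LieSubmodule.lie_le_iff]
  intro x hx v _
  rw [(LieModule.mem_ker F g0 g1 _).1 (hb.ideal_still_le_ker hx) v]
  exact zero_mem _

/-- If `a` commutes with `[g₁, g₁]` and `[g₁, g₁]` kills `u`, then `a` is self-adjoint for the
pairing `(v, w) ↦ ⟨u, v⟩ • w`. -/
theorem lie_bracket_lie_of_still (hb : IsSuperBracket br) {u : g1} (hu : u ∈ hb.still) {a : g0}
    (ha : ∀ x ∈ hb.derived, ⁅a, x⁆ = 0) (v w : g1) :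
    ⁅br u ⁅a, v⁆, w⁆ = ⁅br u v, ⁅a, w⁆⁆ := by
  have hs : ∀ v w : g1, ⁅br u v, w⁆ = -⁅br u w, v⁆ := fun v w =>
    hb.lie_bracket_swap (hu _ (hb.mem_derived v w))
  have hc : ∀ v w : g1, ⁅a, ⁅br u v, w⁆⁆ = ⁅br u v, ⁅a, w⁆⁆ := fun v w => by
    rw [leibniz_lie, ha _ (hb.mem_derived u v), zero_lie, zero_add]
  rw [hs, ← hc, hs, lie_neg, hc, neg_neg]

theorem bracket_lie_of_commuting (hb : IsSuperBracket br) {a : g0}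
    (ha : ∀ x ∈ hb.derived, ⁅a, x⁆ = 0) (v w : g1) : br ⁅a, v⁆ w = -br v ⁅a, w⁆ := by
  rw [eq_neg_iff_add_eq_zero, ← hb.equiv, ha _ (hb.mem_derived v w)]

/-- The ideal `[[g₀, G], H]` of `g₀`, with `G = hb.still` and `H = hb.moved`. -/
abbrev mixed (hb : IsSuperBracket br) : LieIdeal F g0 :=
  hb.ideal ⁅(⊤ : LieIdeal F g0), hb.still⁆ hb.moved

theorem mixed_le_derived (hb : IsSuperBracket br) : hb.mixed ≤ hb.derived :=
  hb.ideal_le fun u _ v _ => hb.mem_derived u v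

theorem lie_self_ne_bot_of_le_mixed
    (hg : ∀ I : LieIdeal F g0, ∃ J, IsCompl I J) (hb : IsSuperBracket br) {S : LieIdeal F g0}
    (hS : S ≠ ⊥) (hSX : S ≤ hb.mixed) : ⁅S, S⁆ ≠ ⊥ := by
  intro hab
  obtain ⟨D, hD⟩ := hg S
  have hD' : ∀ b x : g0, ⁅b, x⁆ ∈ D := fun b x => by
    obtain ⟨s, hs, d, hd, rfl⟩ :=
      (LieSubmodule.mem_sup _ _ _).1 (hD.sup_eq_top.symm ▸ LieSubmodule.mem_top b)
    obtain ⟨s', hs', d', hd', rfl⟩ :=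
      (LieSubmodule.mem_sup _ _ _).1 (hD.sup_eq_top.symm ▸ LieSubmodule.mem_top x)
    have h0 : ⁅s, s'⁆ = 0 := (LieSubmodule.mem_bot _).1 (hab ▸ LieSubmodule.lie_mem_lie hs hs')
    rw [lie_add, add_lie, h0, zero_add]
    exact add_mem (lie_mem_left F g0 D d s' hd) (D.lie_mem hd')
  have hX : hb.mixed ≤ D := hb.ideal_le fun u hu h hh => by
    have hu' : u ∈ hb.still := LieSubmodule.lie_le_right _ _ hu
    have hle : (hb.moved).toSubmodule ≤ D.toSubmodule.comap (br u) :=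
      LieSubmodule.lie_toSubmodule_le fun r hr v _ => by
        change br u ⁅r, v⁆ ∈ D
        rw [← hb.lie_bracket_of_fixed hr hu']
        exact hD' _ _
    exact hle hh
  exact hS (disjoint_self.1 (hD.disjoint.mono_right (hSX.trans hX)))

theorem exists_bracket_lie_ne_zero
    (hg : ∀ I : LieIdeal F g0, ∃ J, IsCompl I J) (hb : IsSuperBracket br) {S : LieIdeal F g0}
    (hS : IsAtom S) (hSX : S ≤ hb.mixed) :
    ∃ u ∈ hb.still, ∃ a : g0, (∀ x ∈ hb.derived, ⁅a, x⁆ = 0) ∧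
      ∃ w ∈ ⁅S, (⊤ : LieSubmodule F g0 g1)⁆, br u ⁅a, w⁆ ≠ 0 := by
  by_contra! hcon
  refine hb.lie_self_ne_bot_of_le_mixed hg hS.1 hSX ?_
  rw [eq_bot_iff, LieSubmodule.lie_le_iff]
  intro s hs x hx
  have hle : hb.mixed.toSubmodule ≤ LinearMap.ker (LieModule.toEnd F g0 g0 s) :=
    hb.ideal_toSubmodule_le fun u hu h _ => by
      have hu' : u ∈ hb.still := LieSubmodule.lie_le_right _ _ hu
      change ⁅s, br u h⁆ = 0
      rw [hb.lie_bracket_of_fixed (hb.mixed_le_derived (hSX hs)) hu']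
      have hU : (⁅(⊤ : LieIdeal F g0), hb.still⁆).toSubmodule ≤
          LinearMap.ker (br.flip ⁅s, h⁆) :=
        LieSubmodule.lie_toSubmodule_le fun b _ g hgm => by
          obtain ⟨r, hr, a, ha, rfl⟩ := hb.derived.exists_add_commuting hg b
          change br ⁅r + a, g⁆ ⁅s, h⁆ = 0
          rw [add_lie, hgm r hr, zero_add, hb.bracket_lie_of_commuting ha,
            hcon g hgm a ha _ (LieSubmodule.lie_mem_lie hs trivial), neg_zero]
      exact hU hu
  exact (LieSubmodule.mem_bot _).2 (hle (hSX hx))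

theorem atom_le_soc (hss : ∀ N : LieSubmodule F g0 g1, ∃ N', IsCompl N N')
    (hg : ∀ I : LieIdeal F g0, ∃ J, IsCompl I J)
    (hb : IsSuperBracket br) {I : LieIdeal F g0} {I1 : LieSubmodule F g0 g1}
    (hI : I.toSubmodule = socEven br ⊥ ⊥) (hI1 : I1.toSubmodule = socOdd br ⊥ ⊥)
    {S : LieIdeal F g0} (hS : IsAtom S) (hSX : S ≤ hb.mixed) : S ≤ I := by
  obtain ⟨u, hu, a, ha, w₀, hw₀, hne⟩ := hb.exists_bracket_lie_ne_zero hg hS hSX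
  have hSR : S ≤ hb.derived := hSX.trans hb.mixed_le_derived
  have haS : ∀ (x : g0) (_ : x ∈ S) (w : g1), ⁅x, ⁅a, w⁆⁆ = ⁅a, ⁅x, w⁆⁆ := fun x hx w => by
    rw [leibniz_lie a, ha x (hSR hx), zero_lie, zero_add]
  set W : LieSubmodule F g0 g1 := ⁅S, (⊤ : LieSubmodule F g0 g1)⁆ with hW
  have hWS : W.toSubmodule.map (br u) = S.toSubmodule := by
    have hle : W.toSubmodule.map (br u) ≤ S.toSubmodule :=
      Submodule.map_le_iff_le_comap.2 <| LieSubmodule.lie_toSubmodule_le fun s hs v _ => by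
        change br u ⁅s, v⁆ ∈ S
        rw [← hb.lie_bracket_of_fixed (hSR hs) hu]
        exact lie_mem_left F g0 S s _ hs
    let T : LieIdeal F g0 :=
      { W.toSubmodule.map (br u) with
        lie_mem := fun {b x} hx => LieIdeal.lie_mem_of_le hg
          (T := W.toSubmodule.map (br u)) (hle.trans hSR) (by
            rintro r hr _ ⟨w, hw, rfl⟩
            rw [hb.lie_bracket_of_fixed hr hu]
            exact ⟨_, W.lie_mem hw, rfl⟩) b hx }
    rcases hS.le_iff.1 (show T ≤ S from hle) with h | h
    · have hmem : br u ⁅a, w₀⁆ ∈ T := ⟨_, W.lie_mem hw₀, rfl⟩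
      exact absurd ((LieSubmodule.mem_bot _).1 (h ▸ hmem)) hne
    · exact congrArg LieSubmodule.toSubmodule h
  have hlift : ∀ x ∈ S, ∃ w ∈ W, br u w = x := fun x hx =>
    Submodule.mem_map.1 (hWS.symm ▸ hx)
  have hWmem : ∀ w ∈ W, br u w ∈ S := fun w hw => by
    rw [← LieSubmodule.mem_toSubmodule, ← hWS]
    exact ⟨w, hw, rfl⟩
  obtain ⟨c, h, hh, hh0, hc⟩ := exists_mem_map_eq_smul (W := W.toSubmodule) (φ := br u)
    (α := LieModule.toEnd F g0 g1 a) (fun w hw => W.lie_mem hw)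
    (by rw [hWS]; exact fun h => hS.1 ((LieSubmodule.toSubmodule_eq_bot S).1 h))
  have hT : ∀ x ∈ S, ∀ w : g1, ⁅x, ⁅a, w⁆ - c • w⁆ = 0 := by
    let T' : Submodule F g0 :=
      { carrier := {x | x ∈ S ∧ ∀ w : g1, ⁅x, ⁅a, w⁆ - c • w⁆ = 0}
        zero_mem' := ⟨zero_mem S, fun w => zero_lie _⟩
        add_mem' := fun {x y} hx hy => ⟨add_mem hx.1 hy.1, fun w => by
          rw [add_lie, hx.2, hy.2, add_zero]⟩
        smul_mem' := fun t x hx => ⟨S.smul_mem t hx.1, fun w => by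
          rw [smul_lie, hx.2, smul_zero]⟩ }
    let T : LieIdeal F g0 :=
      { T' with
        lie_mem := fun {b x} hx => LieIdeal.lie_mem_of_le hg (I := hb.derived) (T := T')
          (fun x hx => hSR hx.1) (fun r hr x hx => ⟨S.lie_mem hx.1, fun w => by
            have h1 : ⁅r, ⁅a, w⁆ - c • w⁆ = ⁅a, ⁅r, w⁆⁆ - c • ⁅r, w⁆ := by
              rw [lie_sub, lie_smul, leibniz_lie a, ha r hr, zero_lie, zero_add]
            rw [lie_lie, hx.2, lie_zero, h1, hx.2, sub_zero]⟩) b hx }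
    have hmem : br u h ∈ T := ⟨hWmem h hh, fun w => by
      have h1 := hb.lie_bracket_lie_of_still hu ha h w
      have h2 : br u ⁅a, h⁆ = c • br u h := hc
      rw [lie_sub, ← h1, h2, smul_lie, lie_smul, sub_self]⟩
    rcases hS.le_iff.1 (show T ≤ S from fun x hx => hx.1) with h' | h'
    · exact absurd ((LieSubmodule.mem_bot _).1 (h' ▸ hmem)) hh0
    · intro x hx
      exact (show x ∈ T from h' ▸ hx).2
  have haW : ∀ w ∈ W, ⁅a, w⁆ = c • w := fun w hw => sub_eq_zero.1 <|
    (LieSubmodule.mem_bot _).1 <| (S.disjoint_lie_top_fixed hss).le_bot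
      ⟨sub_mem (W.lie_mem hw) (W.smul_mem c hw), fun x hx => hT x hx w⟩
  have hc0 : c ≠ 0 := by
    rintro rfl
    rw [haW w₀ hw₀, zero_smul, map_zero] at hne
    exact hne rfl
  have hWW : ∀ w ∈ W, ∀ w' ∈ W, br w w' = 0 := fun w hw w' hw' => by
    have h := hb.bracket_lie_of_commuting ha w w'
    rw [haW w hw, haW w' hw', map_smul, map_smul, LinearMap.smul_apply,
      eq_neg_iff_add_eq_zero, ← two_smul F, smul_eq_zero, smul_eq_zero] at h
    exact (h.resolve_left two_ne_zero).resolve_left hc0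
  have hq : IsIdeal br S.toSubmodule W.toSubmodule := by
    refine isIdeal_iff.2 ⟨fun x hx v => LieSubmodule.lie_mem_lie hx trivial, fun w hw v => ?_⟩
    have hle : W.toSubmodule ≤ S.toSubmodule.comap (br.flip v) :=
      LieSubmodule.lie_toSubmodule_le fun s hs v' _ => by
        change br ⁅s, v'⁆ v ∈ S
        obtain ⟨w', hw', g', hg', rfl⟩ := S.exists_add_fixed hss v
        have h1 := hb.equiv s v' g'
        rw [hg' s hs, map_zero, add_zero] at h1
        rw [map_add, hWW _ (LieSubmodule.lie_mem_lie hs trivial) w' hw', zero_add, ← h1]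
        exact lie_mem_left F g0 S s _ hs
    exact hle hw
  rcases hS.le_iff.1 (inf_le_left : S ⊓ I ≤ S) with hSI | hSI
  · refine absurd (hq.eq_bot_of_disjoint_soc hI hI1 (disjoint_iff.2 hSI) ?_) hS.1
    rw [disjoint_iff, eq_bot_iff]
    rintro w ⟨hw, hwI⟩
    have hII : IsIdeal br I.toSubmodule I1.toSubmodule := by
      rw [hI, hI1]
      exact isIdeal_bot.soc
    have hw0 : br u w = 0 := (LieSubmodule.mem_bot _).1 <| hSI.le
      ⟨hWmem w hw, by rw [hb.symm]; exact (isIdeal_iff.1 hII).2 w hwI u⟩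
    refine (S.disjoint_lie_top_fixed hss).le_bot ⟨hw, fun x hx => ?_⟩
    obtain ⟨h', _, rfl⟩ := hlift x hx
    rw [hb.lie_bracket_swap (hu _ (hb.mem_derived h' w)), hw0, zero_lie, neg_zero]
  · exact inf_eq_left.1 hSI

theorem mixed_le_soc (hss : ∀ N : LieSubmodule F g0 g1, ∃ N', IsCompl N N')
    (hg : ∀ I : LieIdeal F g0, ∃ J, IsCompl I J)
    (hb : IsSuperBracket br) {I : LieIdeal F g0} {I1 : LieSubmodule F g0 g1}
    (hI : I.toSubmodule = socEven br ⊥ ⊥) (hI1 : I1.toSubmodule = socOdd br ⊥ ⊥) :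
    hb.mixed ≤ I := by
  obtain ⟨D, hDX, hDI, hX⟩ := exists_disjoint_le_sup hg hb.mixed I
  rcases IsAtomic.eq_bot_or_exists_atom_le D with rfl | ⟨S, hS, hSD⟩
  · rwa [sup_bot_eq] at hX
  · exact absurd (disjoint_self.1 ((hDI.mono_left hSD).mono_right
      (hb.atom_le_soc hss hg hI hI1 hS (hSD.trans hDX)))) hS.1

end IsSuperBracket

theorem IsIdeal.sup {I D : LieIdeal F g0} {I1 N : LieSubmodule F g0 g1}
    (hI : IsIdeal br I.toSubmodule I1.toSubmodule) (h0 : ∀ x ∈ D, ∀ v : g1, ⁅x, v⁆ ∈ I1 ⊔ N)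
    (h1 : ∀ v ∈ N, ∀ w : g1, br v w ∈ I ⊔ D) :
    IsIdeal br (I ⊔ D).toSubmodule (I1 ⊔ N).toSubmodule := by
  rw [isIdeal_iff] at hI ⊢
  refine ⟨fun x hx v => ?_, fun v hv w => ?_⟩
  · obtain ⟨y, hy, d, hd, rfl⟩ := (LieSubmodule.mem_sup _ _ _).1 hx
    rw [add_lie]
    exact add_mem (LieSubmodule.mem_sup_left (hI.1 y hy v)) (h0 d hd v)
  · obtain ⟨y, hy, d, hd, rfl⟩ := (LieSubmodule.mem_sup _ _ _).1 hv
    rw [map_add, LinearMap.add_apply]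
    exact add_mem (LieSubmodule.mem_sup_left (hI.2 y hy w)) (h1 d hd w)

theorem IsIdeal.le_of_inf_le {I J D : LieIdeal F g0} {I1 J1 N : LieSubmodule F g0 g1}
    (hJ : J.toSubmodule = socEven br I.toSubmodule I1.toSubmodule)
    (hJ1 : J1.toSubmodule = socOdd br I.toSubmodule I1.toSubmodule)
    (hq : IsIdeal br (I ⊔ D).toSubmodule (I1 ⊔ N).toSubmodule) (h0 : D ⊓ J ≤ I)
    (h1 : N ⊓ J1 ≤ I1) : D ≤ I ∧ N ≤ I1 := by
  rw [LieSubmodule.sup_toSubmodule, LieSubmodule.sup_toSubmodule] at hq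
  exact hq.le_of_inf_soc_le (by rw [← hJ]; exact h0) (by rw [← hJ1]; exact h1)

namespace IsSuperBracket

theorem lie_still_le_soc (hss : ∀ N : LieSubmodule F g0 g1, ∃ N', IsCompl N N')
    (hg : ∀ I : LieIdeal F g0, ∃ J, IsCompl I J)
    {I J : LieIdeal F g0} {I1 J1 : LieSubmodule F g0 g1}
    (hI : I.toSubmodule = socEven br ⊥ ⊥) (hI1 : I1.toSubmodule = socOdd br ⊥ ⊥)
    (hJ : J.toSubmodule = socEven br I.toSubmodule I1.toSubmodule)
    (hJ1 : J1.toSubmodule = socOdd br I.toSubmodule I1.toSubmodule)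
    (hb : IsSuperBracket br) : ⁅(⊤ : LieIdeal F g0), hb.still⁆ ≤ J1 := by
  have hII : IsIdeal br I.toSubmodule I1.toSubmodule := by
    rw [hI, hI1]
    exact isIdeal_bot.soc
  have hIJ1 : I1 ≤ J1 := LieSubmodule.toSubmodule_le_toSubmodule _ _ |>.1 (hJ1 ▸ le_sup_left)
  obtain ⟨D, hDU, hDJ, hU⟩ := exists_disjoint_le_sup hss ⁅(⊤ : LieIdeal F g0), hb.still⁆ J1
  have hq : IsIdeal br (I ⊔ ⊥).toSubmodule (I1 ⊔ D).toSubmodule := by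
    refine hII.sup (fun x hx v => ?_) (fun d hd w => LieSubmodule.mem_sup_left ?_)
    · rw [(LieSubmodule.mem_bot _).1 hx, zero_lie]
      exact zero_mem _
    · obtain ⟨h, hh, g, hgm, rfl⟩ := hb.derived.exists_add_fixed hss w
      rw [map_add]
      exact add_mem (hb.mixed_le_soc hss hg hI hI1 (hb.mem_ideal (hDU hd) hh))
        (LieModule.ker_le_soc hg hI hI1 (hb.ideal_still_le_ker
          (hb.mem_ideal (LieSubmodule.lie_le_right _ _ (hDU hd)) hgm)))
  have hD := (hq.le_of_inf_le hJ hJ1 (inf_le_left.trans bot_le) (hDJ.le_bot.trans bot_le)).2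
  exact hU.trans (sup_le le_rfl (hD.trans hIJ1))

theorem ideal_moved_le_soc (hss : ∀ N : LieSubmodule F g0 g1, ∃ N', IsCompl N N')
    (hg : ∀ I : LieIdeal F g0, ∃ J, IsCompl I J)
    {I J : LieIdeal F g0} {I1 J1 : LieSubmodule F g0 g1}
    (hI : I.toSubmodule = socEven br ⊥ ⊥) (hI1 : I1.toSubmodule = socOdd br ⊥ ⊥)
    (hJ : J.toSubmodule = socEven br I.toSubmodule I1.toSubmodule)
    (hJ1 : J1.toSubmodule = socOdd br I.toSubmodule I1.toSubmodule)
    (hb : IsSuperBracket br) : hb.ideal hb.moved ⊤ ≤ J := by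
  have hII : IsIdeal br I.toSubmodule I1.toSubmodule := by
    rw [hI, hI1]
    exact isIdeal_bot.soc
  have hJJ : IsIdeal br J.toSubmodule J1.toSubmodule := by
    rw [hJ, hJ1]
    exact hII.soc
  have hIJ : I ≤ J := LieSubmodule.toSubmodule_le_toSubmodule _ _ |>.1 (hJ ▸ le_sup_left)
  rw [isIdeal_iff] at hJJ
  set P : LieIdeal F g0 := hb.ideal hb.moved ⊤ with hP
  have hPR : P ≤ hb.derived := hb.ideal_le fun u _ v _ => hb.mem_derived u v
  set Z : LieSubmodule F g0 g1 := (P ⊓ J).fixed g1 with hZ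
  set L : LieSubmodule F g0 g1 := hb.moved ⊓ J1 with hL
  have hlie : ∀ x ∈ P ⊓ J, ∀ v : g1, ⁅x, v⁆ ∈ L := fun x hx v =>
    ⟨LieSubmodule.lie_mem_lie (hPR hx.1) trivial, hJJ.1 x hx.2 v⟩
  have hbr : ∀ v ∈ L, ∀ w : g1, br v w ∈ P ⊓ J := fun v hv w =>
    ⟨hb.mem_ideal hv.1 trivial, hJJ.2 v hv.2 w⟩
  have hbr' : ∀ w : g1, ∀ v ∈ L, br w v ∈ P ⊓ J := fun w v hv => hb.symm v w ▸ hbr v hv w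
  have hdec : ∀ v : g1, ∃ h ∈ L, ∃ g ∈ Z, h + g = v := fun v => by
    obtain ⟨h, hh, g, hgm, e⟩ := (P ⊓ J).exists_add_fixed hss v
    exact ⟨h, (LieSubmodule.lie_le_iff _ _ _).2 (fun x hx m _ => hlie x hx m) hh, g, hgm, e⟩
  set M : LieIdeal F g0 := hb.ideal ⁅P, Z⁆ Z with hM
  have hML : ∀ m ∈ M, ∀ h ∈ L, ⁅m, h⁆ = 0 := fun m hm h hh => by
    have hle : M.toSubmodule ≤
        LinearMap.ker ((LieModule.toEnd F g0 g1 : g0 →ₗ[F] Module.End F g1).flip h) :=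
      hb.ideal_toSubmodule_le fun u hu v hv => by
        change ⁅br u v, h⁆ = 0
        have e := hb.jac u v h
        rwa [LieSubmodule.lie_le_right _ _ hu _ (hbr' v h hh), hv _ (hbr h hh u), add_zero,
          add_zero] at e
    exact hle hm
  have hMP : ∀ x ∈ P ⊓ J, ∀ m ∈ M, ⁅x, m⁆ = 0 := fun x hx m hm => by
    have hle : M.toSubmodule ≤ LinearMap.ker (LieModule.toEnd F g0 g0 x) :=
      hb.ideal_toSubmodule_le fun u hu v hv => by
        change ⁅x, br u v⁆ = 0
        rw [hb.equiv, LieSubmodule.lie_le_right _ _ hu x hx, hv x hx, map_zero, map_zero,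
          LinearMap.zero_apply, add_zero]
    exact hle hm
  have hPM : P ≤ P ⊓ J ⊔ M := hb.ideal_le fun u hu w _ => by
    have hle : (⁅P, (⊤ : LieSubmodule F g0 g1)⁆).toSubmodule ≤
        (P ⊓ J ⊔ M).toSubmodule.comap (br.flip w) :=
      LieSubmodule.lie_toSubmodule_le fun p hp v _ => by
        change br ⁅p, v⁆ w ∈ P ⊓ J ⊔ M
        obtain ⟨h, hh, g, hgm, rfl⟩ := hdec v
        obtain ⟨h', hh', g', hgm', rfl⟩ := hdec w
        rw [lie_add, map_add br, LinearMap.add_apply, map_add (br ⁅p, g⁆)]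
        exact add_mem (LieSubmodule.mem_sup_left (hbr _ (L.lie_mem hh) _))
          (add_mem (LieSubmodule.mem_sup_left (hbr' _ _ hh'))
            (LieSubmodule.mem_sup_right (hb.mem_ideal (LieSubmodule.lie_mem_lie hp hgm) hgm')))
    exact hle (hb.moved_le hss hu)
  have hMleP : M ≤ P := hb.ideal_le fun u hu v _ =>
    hb.mem_ideal (LieSubmodule.mono_lie hPR le_top hu) trivial
  have hq : IsIdeal br (I ⊔ M).toSubmodule
      (I1 ⊔ ⁅M, (⊤ : LieSubmodule F g0 g1)⁆).toSubmodule := by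
    refine hII.sup (fun m hm v => LieSubmodule.mem_sup_right
      (LieSubmodule.lie_mem_lie hm trivial)) (fun u hu w => LieSubmodule.mem_sup_right ?_)
    have hle : (⁅M, (⊤ : LieSubmodule F g0 g1)⁆).toSubmodule ≤
        M.toSubmodule.comap (br.flip w) :=
      LieSubmodule.lie_toSubmodule_le fun m hm v _ => by
        change br ⁅m, v⁆ w ∈ M
        obtain ⟨h, hh, g, hgm, rfl⟩ := hdec v
        obtain ⟨h', hh', g', hgm', rfl⟩ := hdec w
        have e := hb.equiv m g h'
        rw [hML m hm h' hh', map_zero, add_zero, ← lie_skew,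
          hMP _ (hbr' g h' hh') m hm, neg_zero] at e
        rw [lie_add, hML m hm h hh, zero_add, map_add, ← e, zero_add]
        exact hb.mem_ideal (LieSubmodule.lie_mem_lie (hMleP hm) hgm) hgm'
    exact hle hu
  have hMI := (hq.le_of_inf_le hJ hJ1 (fun m hm => ?_) (fun v hv => ?_)).1
  · exact hPM.trans (sup_le inf_le_right (hMI.trans hIJ))
  · refine LieModule.ker_le_soc hg hI hI1 ((LieModule.mem_ker F g0 g1 _).2 fun v => ?_)
    obtain ⟨h, hh, g, hgm, rfl⟩ := hdec v
    rw [lie_add, hML m hm.1 h hh, hgm m ⟨hMleP hm.1, hm.2⟩, add_zero]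
  · have hvL : v ∈ L := ⟨LieSubmodule.mono_lie_left _ (hMleP.trans hPR) hv.1, hv.2⟩
    exact bot_le (a := I1) ((M.disjoint_lie_top_fixed hss).le_bot
      ⟨hv.1, fun m hm => hML m hm v hvL⟩)

theorem derived_le_soc (hss : ∀ N : LieSubmodule F g0 g1, ∃ N', IsCompl N N')
    (hg : ∀ I : LieIdeal F g0, ∃ J, IsCompl I J)
    {I J : LieIdeal F g0} {I1 J1 : LieSubmodule F g0 g1}
    (hI : I.toSubmodule = socEven br ⊥ ⊥) (hI1 : I1.toSubmodule = socOdd br ⊥ ⊥)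
    (hJ : J.toSubmodule = socEven br I.toSubmodule I1.toSubmodule)
    (hJ1 : J1.toSubmodule = socOdd br I.toSubmodule I1.toSubmodule)
    (hb : IsSuperBracket br) : hb.derived ≤ J := by
  have hIJ : I ≤ J := LieSubmodule.toSubmodule_le_toSubmodule _ _ |>.1 (hJ ▸ le_sup_left)
  exact (hb.derived_le hss).trans (sup_le (hb.ideal_still_le_ker.trans
    ((LieModule.ker_le_soc hg hI hI1).trans hIJ)) (hb.ideal_moved_le_soc hss hg hI hI1 hJ hJ1))

theorem lie_mem_soc (hss : ∀ N : LieSubmodule F g0 g1, ∃ N', IsCompl N N')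
    (hg : ∀ I : LieIdeal F g0, ∃ J, IsCompl I J)
    {I J : LieIdeal F g0} {I1 J1 : LieSubmodule F g0 g1}
    (hI : I.toSubmodule = socEven br ⊥ ⊥) (hI1 : I1.toSubmodule = socOdd br ⊥ ⊥)
    (hJ : J.toSubmodule = socEven br I.toSubmodule I1.toSubmodule)
    (hJ1 : J1.toSubmodule = socOdd br I.toSubmodule I1.toSubmodule)
    (hb : IsSuperBracket br) (b : g0) (v : g1) : ⁅b, v⁆ ∈ J1 := by
  have hJJ : IsIdeal br J.toSubmodule J1.toSubmodule := by
    rw [hJ, hJ1, hI, hI1]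
    exact isIdeal_bot.soc.soc
  obtain ⟨h, hh, g, hgm, rfl⟩ := hb.derived.exists_add_fixed hss v
  rw [lie_add]
  refine add_mem ((LieSubmodule.lie_le_iff _ _ _).2 (fun x hx w _ => ?_) (hb.moved.lie_mem hh))
    (hb.lie_still_le_soc hss hg hI hI1 hJ hJ1 (LieSubmodule.lie_mem_lie trivial hgm))
  exact (isIdeal_iff.1 hJJ).1 x (hb.derived_le_soc hss hg hI hI1 hJ hJ1 hx) w

end IsSuperBracket

/-- If an ideal contains all brackets involving `g₁`, then the quotient by it is the sum of its
minimal ideals. -/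
theorem IsIdeal.soc_eq_top (hg : ∀ I : LieIdeal F g0, ∃ J, IsCompl I J) {J : LieIdeal F g0}
    {J1 : LieSubmodule F g0 g1} (hbr : ∀ v w : g1, br v w ∈ J)
    (hlie : ∀ (a : g0) (v : g1), ⁅a, v⁆ ∈ J1) :
    socEven br J.toSubmodule J1.toSubmodule = ⊤ ∧
      socOdd br J.toSubmodule J1.toSubmodule = ⊤ := by
  have hJJ : IsIdeal br J.toSubmodule J1.toSubmodule :=
    isIdeal_iff.2 ⟨fun x _ v => hlie x v, fun v _ w => hbr v w⟩
  obtain ⟨S, S1, hS, hS1⟩ := hJJ.soc.exists_lie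
  obtain ⟨C, hC⟩ := hg S
  obtain ⟨C1, hC1⟩ := Submodule.exists_isCompl (socOdd br J.toSubmodule J1.toSubmodule)
  have hq : IsIdeal br (J.toSubmodule ⊔ C.toSubmodule) (J1.toSubmodule ⊔ C1) := by
    rw [← LieSubmodule.sup_toSubmodule]
    exact ⟨fun a x hx => (J ⊔ C).lie_mem hx, fun a v _ => Submodule.mem_sup_left (hlie a v),
      fun x _ v => Submodule.mem_sup_left (hlie x v),
      fun v _ w => (le_sup_left : J ≤ J ⊔ C) (hbr v w)⟩
  obtain ⟨h0, h1⟩ := hq.le_of_inf_soc_le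
    (by rw [← hS]; exact hC.disjoint.symm.le_bot.trans bot_le)
    (hC1.disjoint.symm.le_bot.trans bot_le)
  constructor
  · have hCS : C ≤ S := by
      rw [← LieSubmodule.toSubmodule_le_toSubmodule, hS]
      exact h0.trans le_sup_left
    rw [← hS, LieSubmodule.toSubmodule_eq_top, ← hC.sup_eq_top, sup_eq_left.2 hCS]
  · rw [← hC1.sup_eq_top, eq_comm, sup_eq_left]
    exact h1.trans le_sup_left

theorem stmt10
    (br : g1 →ₗ[F] g1 →ₗ[F] g0)
    (hsymm : ∀ v w : g1, br v w = br w v)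
    (hequiv : ∀ (a : g0) (v w : g1), ⁅a, br v w⁆ = br ⁅a, v⁆ w + br v ⁅a, w⁆)
    (hjac : ∀ u v w : g1, ⁅br u v, w⁆ + ⁅br v w, u⁆ + ⁅br w u, v⁆ = 0)
    (hred : LieAlgebra.radical F g0 = LieAlgebra.center F g0)
    (hss : ∀ N : LieSubmodule F g0 g1, ∃ N', IsCompl N N') :
    ∃ (i0 : Submodule F g0) (i1 : Submodule F g1)
      (j0 : Submodule F g0) (j1 : Submodule F g1),
      IsIdeal br i0 i1 ∧ IsIdeal br j0 j1 ∧ i0 ≤ j0 ∧ i1 ≤ j1 ∧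
      -- i is the sum of all minimal ideals of g:
      i0 = socEven br ⊥ ⊥ ∧ i1 = socOdd br ⊥ ⊥ ∧
      -- the image of j in g/i is the sum of all minimal ideals of g/i:
      j0 = socEven br i0 i1 ∧ j1 = socOdd br i0 i1 ∧
      -- g/j is the sum of all of its own minimal ideals:
      socEven br j0 j1 = ⊤ ∧ socOdd br j0 j1 = ⊤ := by
  have hb : IsSuperBracket br := ⟨hsymm, hequiv, hjac⟩
  have hg := LieAlgebra.exists_isCompl_of_radical_eq_center hred
  have hi : IsIdeal br (socEven br ⊥ ⊥) (socOdd br ⊥ ⊥) := isIdeal_bot.soc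
  obtain ⟨I, I1, hI, hI1⟩ := hi.exists_lie
  rw [← hI, ← hI1] at hi
  obtain ⟨J, J1, hJ, hJ1⟩ := hi.soc.exists_lie
  have hj : IsIdeal br J.toSubmodule J1.toSubmodule := by
    rw [hJ, hJ1]
    exact hi.soc
  refine ⟨I.toSubmodule, I1.toSubmodule, J.toSubmodule, J1.toSubmodule, hi, hj,
    hJ ▸ le_sup_left, hJ1 ▸ le_sup_left, hI, hI1, hJ, hJ1, ?_⟩
  exact IsIdeal.soc_eq_top hg
    (fun v w => hb.derived_le_soc hss hg hI hI1 hJ hJ1 (hb.mem_derived v w))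
    (hb.lie_mem_soc hss hg hI hI1 hJ hJ1)
end

section
/- Let ĝ be a quasireductive finite-dimensional Lie superalgebra over F and let z ∈ ĝ₁ be a nonzero element with a • z = 0 for all a ∈ ĝ₀ and ⟨z, v⟩ = 0 for all v ∈ ĝ₁. Then there exists an ideal i of ĝ with i₀ = ĝ₀ and ĝ₁ = i₁ ⊕ Fz. (Every one-dimensional odd central extension of a quasireductive Lie superalgebra splits.) -/
/- STATEMENT 11: a one-dimensional odd central extension of a quasireductive Lie superalgebra
splits: if z ∈ ĝ₁ is nonzero with ĝ₀ • z = 0 and ⟨z, ĝ₁⟩ = 0, then there is an ideal i of ĝ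
with i₀ = ĝ₀ and ĝ₁ = i₁ ⊕ Fz. -/

variable {F : Type} [Field F] [IsAlgClosed F] [CharZero F]
variable {g0 : Type} [LieRing g0] [LieAlgebra F g0] [FiniteDimensional F g0]
variable {g1 : Type} [AddCommGroup g1] [Module F g1] [FiniteDimensional F g1]
variable [LieRingModule g0 g1] [LieModule F g0 g1]

theorem stmt11
    (br : g1 →ₗ[F] g1 →ₗ[F] g0)
    (hsymm : ∀ v w : g1, br v w = br w v)
    (hequiv : ∀ (a : g0) (v w : g1), ⁅a, br v w⁆ = br ⁅a, v⁆ w + br v ⁅a, w⁆)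
    (hjac : ∀ u v w : g1, ⁅br u v, w⁆ + ⁅br v w, u⁆ + ⁅br w u, v⁆ = 0)
    (hred : LieAlgebra.radical F g0 = LieAlgebra.center F g0)
    (hss : ∀ N : LieSubmodule F g0 g1, ∃ N', IsCompl N N')
    (z : g1) (hz : z ≠ 0)
    (hzc : ∀ a : g0, ⁅a, z⁆ = 0)
    (hzb : ∀ v : g1, br z v = 0) :
    ∃ i1 : Submodule F g1,
      IsIdeal br ⊤ i1 ∧ IsCompl i1 (Submodule.span F {z}) := by
  let N : LieSubmodule F g0 g1 :=
    { Submodule.span F {z} with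
      lie_mem := by
        intro a v hv
        obtain ⟨c, rfl⟩ := Submodule.mem_span_singleton.mp hv
        simp [hzc a] }
  obtain ⟨C, hC⟩ := hss N
  have hC' : IsCompl (C : Submodule F g1) (Submodule.span F {z}) :=
    (LieSubmodule.isCompl_toSubmodule.mpr hC).symm
  refine ⟨C, ⟨fun _ _ _ => trivial, fun _ _ hv => C.lie_mem hv, fun a _ v => ?_,
    fun _ _ _ => trivial⟩, hC'⟩
  obtain ⟨c, hc, y, hy, rfl⟩ := Submodule.mem_sup.mp (hC'.sup_eq_top ▸ Submodule.mem_top (x := v))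
  obtain ⟨t, rfl⟩ := Submodule.mem_span_singleton.mp hy
  simpa [hzc a] using C.lie_mem hc
end

section
/- Let g be a quasireductive finite-dimensional Lie superalgebra over F and let V = span{⟨v, w⟩ : v, w ∈ g₁} ⊆ g₀. Then the space of symmetric bilinear forms c on g₁ that are g₀-invariant (c(a • v, w) + c(v, a • w) = 0 for all a, v, w) and of the form c(v, w) = f(⟨v, w⟩) for some linear functional f on g₀ has dimension equal to dim(Z(g₀) ∩ V). (This is the space of invariant coboundaries, giving dim H²_r(g) = dim of the space of g₀-invariant symmetric bilinear forms on g₁ minus dim(Z(g₀) ∩ [g₁, g₁]).) -/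
/- STATEMENT 14: for a quasireductive g, the space of g₀-invariant symmetric bilinear forms
on g₁ which are coboundaries (i.e. of the form f∘⟨·,·⟩) has dimension dim(Z(g₀) ∩ ⟨g₁,g₁⟩). -/

variable {F : Type} [Field F] [IsAlgClosed F] [CharZero F]
variable {g0 : Type} [LieRing g0] [LieAlgebra F g0] [FiniteDimensional F g0]
variable {g1 : Type} [AddCommGroup g1] [Module F g1] [FiniteDimensional F g1]
variable [LieRingModule g0 g1] [LieModule F g0 g1]

/-- The space of symmetric, g₀-invariant bilinear forms on g₁ of the form f∘⟨·,·⟩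
(invariant coboundaries). -/
def cobSpace (br : g1 →ₗ[F] g1 →ₗ[F] g0) : Submodule F (g1 →ₗ[F] g1 →ₗ[F] F) where
  carrier := {c | (∀ v w : g1, c v w = c w v) ∧
    (∀ (a : g0) (v w : g1), c ⁅a, v⁆ w + c v ⁅a, w⁆ = 0) ∧
    ∃ f : g0 →ₗ[F] F, ∀ v w : g1, c v w = f (br v w)}
  zero_mem' := ⟨fun _ _ => rfl, fun _ _ _ => by simp,
    ⟨0, fun _ _ => by simp⟩⟩
  add_mem' := by
    rintro c c' ⟨hs, hi, f, hf⟩ ⟨hs', hi', f', hf'⟩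
    refine ⟨fun v w => ?_, fun a v w => ?_, ⟨f + f', fun v w => ?_⟩⟩
    · simp only [LinearMap.add_apply]; rw [hs, hs']
    · simp only [LinearMap.add_apply]
      linear_combination hi a v w + hi' a v w
    · simp only [LinearMap.add_apply]; rw [hf, hf']
  smul_mem' := by
    rintro t c ⟨hs, hi, f, hf⟩
    refine ⟨fun v w => ?_, fun a v w => ?_, ⟨t • f, fun v w => ?_⟩⟩
    · simp only [LinearMap.smul_apply]; rw [hs]
    · simp only [LinearMap.smul_apply, smul_eq_mul]
      linear_combination t * hi a v w
    · simp only [LinearMap.smul_apply, smul_eq_mul]; rw [hf]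

/-- A symmetric bilinear form over a field of characteristic different from two admits a pair of
families which behave like dual bases modulo the kernel of the form. -/
lemma LinearMap.BilinForm.IsSymm.exists_dual_families {K V : Type*} [Field K] [CharZero K]
    [AddCommGroup V] [Module K V] [FiniteDimensional K V] {B : LinearMap.BilinForm K V}
    (hB : LinearMap.IsSymm B) :
    ∃ (n : ℕ) (x x' : Fin n → V), ∀ y z, B y z = ∑ i, B y (x' i) * B (x i) z := by
  have : Invertible (2 : K) := invertibleOfNonzero two_ne_zero
  obtain ⟨b, hb⟩ := LinearMap.BilinForm.exists_orthogonal_basis hB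
  refine ⟨_, b, fun i ↦ (B (b i) (b i))⁻¹ • b i, fun y z ↦ ?_⟩
  suffices h : B y = ∑ i, B y ((B (b i) (b i))⁻¹ • b i) • B (b i) by
    conv_lhs => rw [h]
    simp
  refine b.ext fun j ↦ ?_
  have horth (i) (hij : i ≠ j) : B (b i) (b j) = 0 := hb hij
  rw [LinearMap.sum_apply, Finset.sum_eq_single j (fun i _ hij ↦ by simp [horth i hij]) (by simp)]
  rcases eq_or_ne (B (b j) (b j)) 0 with h | h
  · have hj : B (b j) = 0 := b.ext fun i ↦ by
      rcases eq_or_ne i j with rfl | hij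
      · simpa using h
      · rw [show B (b j) (b i) = B (b i) (b j) from hB.eq _ _, horth i hij, LinearMap.zero_apply]
    rw [show B y (b j) = B (b j) y from hB.eq _ _, hj]
    simp
  · simp only [map_smul, smul_eq_mul, LinearMap.smul_apply]
    field_simp

namespace LieAlgebra

variable {K L : Type*} [Field K] [CharZero K] [LieRing L] [LieAlgebra K L] [FiniteDimensional K L]

/-- If the radical of a Lie algebra is central, then its centre is the kernel of the Killing
form. -/
lemma mem_center_iff_killingForm_eq_zero (h : radical K L = center K L) {z : L} :
    z ∈ center K L ↔ ∀ y, killingForm K L z y = 0 := by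
  refine ⟨fun hz y ↦ ?_, fun hz ↦ ?_⟩
  · have : ad K L z = 0 := by
      ext w
      rw [ad_apply, ← lie_skew, (LieModule.mem_maxTrivSubmodule K L L z).mp hz w]
      simp
    rw [killingForm_apply_apply, this, LinearMap.zero_comp, map_zero]
  · rw [← h]
    refine killingCompl_top_le_radical K L ((LieIdeal.mem_killingCompl K L ⊤).mpr fun y _ ↦ ?_)
    rw [LieModule.traceForm_comm]
    exact hz y

/-- Expansion of a bracket along families which are dual for the Killing form. -/
lemma lie_eq_sum_killingForm_smul (h : radical K L = center K L) {n : ℕ} {x x' : Fin n → L}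
    (hx : ∀ y z, killingForm K L y z = ∑ i, killingForm K L y (x' i) * killingForm K L (x i) z)
    (u w : L) : ⁅u, w⁆ = ∑ i, killingForm K L u (x' i) • ⁅x i, w⁆ := by
  have hz : u - ∑ i, killingForm K L u (x' i) • x i ∈ center K L := by
    rw [mem_center_iff_killingForm_eq_zero h]
    intro y
    simp [hx u y]
  have hzw := (LieModule.mem_maxTrivSubmodule K L L _).mp hz w
  rw [← lie_skew, neg_eq_zero, sub_lie, sub_eq_zero, sum_lie] at hzw
  simpa using hzw

/-- A Lie algebra with central radical has a projection onto its centre which is equivariant and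
which, on each ideal `I`, is congruent to the identity modulo `⁅⊤, I⁆`. It is the complement of the
Casimir operator of the adjoint representation. -/
lemma exists_projection_center (h : radical K L = center K L) :
    ∃ P : L →ₗ[K] L, (∀ x, P x ∈ center K L) ∧ (∀ z ∈ center K L, P z = z) ∧
      (∀ a x : L, P ⁅a, x⁆ = 0) ∧
      ∀ I : LieIdeal K L, ∀ x ∈ I, x - P x ∈ ⁅(⊤ : LieIdeal K L), I⁆ := by
  set κ := killingForm K L with hκ
  have κ_symm (u v : L) : κ u v = κ v u := LieModule.traceForm_comm K L L u v
  have κ_lie (u v w : L) : κ ⁅u, v⁆ w = κ u ⁅v, w⁆ := LieModule.traceForm_apply_lie_apply K L L u v w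
  obtain ⟨n, x, x', hx⟩ := LinearMap.BilinForm.IsSymm.exists_dual_families
    (LieModule.traceForm_isSymm K L L)
  replace hx (y z : L) : κ y z = ∑ i, κ y (x' i) * κ (x i) z := hx y z
  have hx' (y z : L) : κ y z = ∑ i, κ y (x i) * κ (x' i) z := by
    rw [κ_symm, hx]
    refine Finset.sum_congr rfl fun i _ ↦ ?_
    rw [κ_symm z, κ_symm _ y, mul_comm]
  let C : L →ₗ[K] L := ∑ i, ad K L (x i) ∘ₗ ad K L (x' i)
  have C_apply (y : L) : C y = ∑ i, ⁅x i, ⁅x' i, y⁆⁆ := by simp [C]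
  have C_lie (a y : L) : C ⁅a, y⁆ = ⁅a, C y⁆ := by
    have h₁ : ∑ i, ⁅⁅a, x i⁆, ⁅x' i, y⁆⁆ + ∑ i, ⁅x i, ⁅⁅a, x' i⁆, y⁆⁆ = 0 := by
      simp_rw [fun i ↦ lie_eq_sum_killingForm_smul h hx ⁅a, x i⁆,
        fun i ↦ lie_eq_sum_killingForm_smul h hx' ⁅a, x' i⁆, lie_sum, lie_smul]
      rw [Finset.sum_comm, ← Finset.sum_add_distrib]
      refine Finset.sum_eq_zero fun j _ ↦ ?_
      rw [← Finset.sum_add_distrib]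
      refine Finset.sum_eq_zero fun i _ ↦ ?_
      have : killingForm K L ⁅a, x' j⁆ (x i) = - killingForm K L ⁅a, x i⁆ (x' j) := by
        rw [← lie_skew a (x' j), ← hκ, map_neg, LinearMap.neg_apply, κ_lie, κ_symm]
      rw [this, neg_smul, add_neg_cancel]
    have h₂ (i) : ⁅a, ⁅x i, ⁅x' i, y⁆⁆⁆ =
        ⁅⁅a, x i⁆, ⁅x' i, y⁆⁆ + ⁅x i, ⁅⁅a, x' i⁆, y⁆⁆ + ⁅x i, ⁅x' i, ⁅a, y⁆⁆⁆ := by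
      rw [leibniz_lie a (x i), leibniz_lie a (x' i), lie_add, add_assoc]
    simp_rw [C_apply, lie_sum, h₂, Finset.sum_add_distrib, h₁, zero_add]
  have C_center (z : L) (hz : z ∈ center K L) : C z = 0 := by
    simp [C_apply, fun y ↦ (LieModule.mem_maxTrivSubmodule K L L z).mp hz y]
  have C_sub (y : L) : y - C y ∈ center K L := by
    rw [mem_center_iff_killingForm_eq_zero h]
    intro w
    have key : ad K L y ∘ₗ ad K L w =
        ∑ i, (κ.flip (x' i)).smulRight ⁅y, ⁅w, x i⁆⁆ := by
      ext v
      have := lie_eq_sum_killingForm_smul h hx v w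
      rw [LinearMap.comp_apply, ad_apply, ad_apply, ← lie_skew w v, this,
        ← Finset.sum_neg_distrib, lie_sum, LinearMap.sum_apply]
      refine Finset.sum_congr rfl fun i _ ↦ ?_
      rw [← smul_neg, lie_skew, lie_smul]
      rfl
    have h₁ : κ y w = ∑ i, κ ⁅y, ⁅w, x i⁆⁆ (x' i) := by
      rw [hκ, killingForm_apply_apply, key, map_sum]
      simp [LinearMap.trace_smulRight, hκ]
    rw [map_sub, LinearMap.sub_apply, sub_eq_zero, ← hκ, h₁, C_apply, map_sum, LinearMap.sum_apply]
    refine Finset.sum_congr rfl fun i _ ↦ ?_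
    rw [← lie_skew y, map_neg, LinearMap.neg_apply, κ_lie, κ_symm, ← lie_skew w, map_neg, neg_neg,
      ← κ_lie, ← lie_skew _ (x i), ← lie_neg, lie_skew]
  refine ⟨LinearMap.id - C, C_sub, fun z hz ↦ by simp [C_center z hz], fun a y ↦ ?_,
    fun I y hy ↦ ?_⟩
  · have := (LieModule.mem_maxTrivSubmodule K L L _).mp (C_sub y) a
    rwa [lie_sub, ← C_lie] at this
  · rw [LinearMap.sub_apply, LinearMap.id_apply, sub_sub_cancel, C_apply]
    exact sum_mem fun i _ ↦ LieSubmodule.lie_mem_lie (LieSubmodule.mem_top _) (I.lie_mem hy)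

end LieAlgebra

theorem stmt14
    (br : g1 →ₗ[F] g1 →ₗ[F] g0)
    (hsymm : ∀ v w : g1, br v w = br w v)
    (hequiv : ∀ (a : g0) (v w : g1), ⁅a, br v w⁆ = br ⁅a, v⁆ w + br v ⁅a, w⁆)
    (hjac : ∀ u v w : g1, ⁅br u v, w⁆ + ⁅br v w, u⁆ + ⁅br w u, v⁆ = 0)
    (hred : LieAlgebra.radical F g0 = LieAlgebra.center F g0)
    (hss : ∀ N : LieSubmodule F g0 g1, ∃ N', IsCompl N N') :
    Module.finrank F (cobSpace br) =
      Module.finrank F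
        (((LieAlgebra.center F g0 : LieIdeal F g0) : Submodule F g0) ⊓
          Submodule.span F {x : g0 | ∃ v w : g1, x = br v w} : Submodule F g0) := by
  obtain ⟨P, hPZ, hPid, hPlie, hPI⟩ := LieAlgebra.exists_projection_center hred
  set V := Submodule.span F {x : g0 | ∃ v w : g1, x = br v w} with hV
  have hbr (v w : g1) : br v w ∈ V := Submodule.subset_span ⟨v, w, rfl⟩
  have hVlie (a : g0) {x : g0} (hx : x ∈ V) : ⁅a, x⁆ ∈ V := by
    induction hx using Submodule.span_induction with
    | mem x hx =>
      obtain ⟨v, w, rfl⟩ := hx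
      exact hequiv a v w ▸ add_mem (hbr _ _) (hbr _ _)
    | zero => simp
    | add x y _ _ hx hy => exact lie_add a x y ▸ add_mem hx hy
    | smul t x _ hx => exact lie_smul t a x ▸ V.smul_mem t hx
  let I : LieIdeal F g0 := { V with lie_mem := hVlie _ }
  have hIV : ⁅(⊤ : LieIdeal F g0), I⁆ ≤ I := LieSubmodule.lie_le_right I ⊤
  have hPV (x : g0) (hx : x ∈ V) : P x ∈ V := by
    have := sub_mem (show x ∈ I from hx) (hIV (hPI I x hx))
    rwa [sub_sub_cancel] at this
  let W : Submodule F g0 := ((LieAlgebra.center F g0 : LieIdeal F g0) : Submodule F g0) ⊓ V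
  let Q : V →ₗ[F] W := (P.comp V.subtype).codRestrict W fun x ↦ ⟨hPZ x, hPV x x.2⟩
  let β : g1 →ₗ[F] g1 →ₗ[F] V := LinearMap.mk₂ F (fun v w ↦ ⟨br v w, hbr v w⟩)
    (fun _ _ _ ↦ by ext; simp) (fun _ _ _ ↦ by ext; simp) (fun _ _ _ ↦ by ext; simp)
    (fun _ _ _ ↦ by ext; simp)
  let Φ : Module.Dual F W →ₗ[F] cobSpace br :=
    { toFun := fun f ↦ ⟨β.compr₂ (f ∘ₗ Q), by
        refine ⟨fun v w ↦ ?_, fun a v w ↦ ?_, ?_⟩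
        · have : β v w = β w v := Subtype.ext (hsymm v w)
          simp [this]
        · have : Q (β ⁅a, v⁆ w + β v ⁅a, w⁆) = 0 :=
            Subtype.ext (by
              change P (br ⁅a, v⁆ w + br v ⁅a, w⁆) = 0
              rw [← hequiv, hPlie])
          simp only [LinearMap.compr₂_apply, LinearMap.comp_apply]
          rw [← map_add, ← map_add, this, map_zero]
        · obtain ⟨g, hg⟩ := LinearMap.exists_extend (f ∘ₗ Q)
          exact ⟨g, fun v w ↦ (LinearMap.congr_fun hg (β v w)).symm⟩⟩
      map_add' := fun _ _ ↦ rfl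
      map_smul' := fun _ _ ↦ rfl }
  have hinj : Function.Injective Φ := by
    rw [injective_iff_map_eq_zero]
    intro f hf
    obtain ⟨g, hg⟩ := LinearMap.exists_extend (f ∘ₗ Q)
    have hgV : V ≤ LinearMap.ker g := by
      rw [hV, Submodule.span_le]
      rintro _ ⟨v, w, rfl⟩
      have h₁ : f (Q (β v w)) = 0 :=
        LinearMap.congr_fun (LinearMap.congr_fun (congrArg Subtype.val hf) v) w
      exact (LinearMap.congr_fun hg (β v w)).trans h₁
    ext x
    have h₁ : Q ⟨x, x.2.2⟩ = x := Subtype.ext (hPid x x.2.1)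
    have h₂ : f (Q ⟨x, x.2.2⟩) = 0 :=
      (LinearMap.congr_fun hg ⟨x, x.2.2⟩).symm.trans (hgV x.2.2)
    rwa [h₁] at h₂
  have hsurj : Function.Surjective Φ := by
    rintro ⟨c, hc₁, hc₂, g, hg⟩
    have hglie (a x : g0) (hx : x ∈ V) : g ⁅a, x⁆ = 0 := by
      induction hx using Submodule.span_induction with
      | mem x hx =>
        obtain ⟨v, w, rfl⟩ := hx
        rw [hequiv, map_add, ← hg, ← hg, hc₂]
      | zero => simp
      | add x y _ _ hx hy => rw [lie_add, map_add, hx, hy, add_zero]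
      | smul t x _ hx => rw [lie_smul, map_smul, hx, smul_zero]
    have hgI : (⁅(⊤ : LieIdeal F g0), I⁆ : LieIdeal F g0).toSubmodule ≤ LinearMap.ker g := by
      rw [LieSubmodule.lieIdeal_oper_eq_linear_span', Submodule.span_le]
      rintro _ ⟨a, _, x, hx, rfl⟩
      exact hglie a x hx
    refine ⟨g ∘ₗ W.subtype, Subtype.ext ?_⟩
    ext v w
    change g (P (br v w)) = c v w
    have : g (br v w - P (br v w)) = 0 := hgI (hPI I _ (hbr v w))
    rw [hg, eq_comm, ← sub_eq_zero, ← map_sub, this]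
  rw [← (LinearEquiv.ofBijective Φ ⟨hinj, hsurj⟩).finrank_eq]
  exact Subspace.dual_finrank_eq
end

section
/- Let g be a quasireductive finite-dimensional Lie superalgebra over F. Then for all v, w ∈ g₁ the trace on g₁ of the operator u ↦ ⟨v,w⟩ • u is zero. Consequently the even linear functional f : g₀ → F defined by f(x) = tr_{g₁}(u ↦ x • u), extended by zero on g₁, is a character of g: it vanishes on [g₀, g₀] and on ⟨g₁, g₁⟩. -/
/- STATEMENT 16: for a quasireductive finite-dimensional Lie superalgebra g, the trace on g₁
of the action of ⟨v,w⟩ is zero for all v, w ∈ g₁; consequently the functional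
f(x) = tr_{g₁}(x • ·) is a character of g: it vanishes on [g₀,g₀] and on ⟨g₁,g₁⟩. -/

variable {F : Type} [Field F] [IsAlgClosed F] [CharZero F]
variable {g0 : Type} [LieRing g0] [LieAlgebra F g0] [FiniteDimensional F g0]
variable {g1 : Type} [AddCommGroup g1] [Module F g1] [FiniteDimensional F g1]
variable [LieRingModule g0 g1] [LieModule F g0 g1]

theorem LieModule.trace_toEnd_lie (K L M : Type*) [CommRing K] [LieRing L] [LieAlgebra K L]
    [AddCommGroup M] [Module K M] [LieRingModule L M] [LieModule K L M] (x y : L) :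
    LinearMap.trace K M (LieModule.toEnd K L M ⁅x, y⁆) = 0 := by
  have : LieModule.toEnd K L M ⁅x, y⁆ = LieModule.toEnd K L M x * LieModule.toEnd K L M y -
      LieModule.toEnd K L M y * LieModule.toEnd K L M x := by
    ext m
    simp
  rw [this, map_sub, LinearMap.trace_mul_comm, sub_self]

/-- A reductive Lie algebra in characteristic zero is unimodular. -/
theorem LieAlgebra.trace_ad_eq_zero_of_hasCentralRadical {K L : Type*} [Field K] [CharZero K]
    [LieRing L] [LieAlgebra K L] [FiniteDimensional K L] [LieAlgebra.HasCentralRadical K L]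
    (x : L) : LinearMap.trace K L (LieAlgebra.ad K L x) = 0 := by
  have mem_center {a : L} (ha : ∀ b, killingForm K L a b = 0) : a ∈ LieAlgebra.center K L := by
    rw [← LieAlgebra.radical_eq_center]
    refine LieAlgebra.killingCompl_top_le_radical K L ?_
    rw [LieIdeal.mem_killingCompl]
    exact fun b _ ↦ by rw [LieModule.traceForm_comm]; exact ha b
  have ad_center {a : L} (ha : a ∈ LieAlgebra.center K L) : LieAlgebra.ad K L a = 0 := by
    ext b
    rw [LieAlgebra.ad_apply, ← lie_skew, (LieModule.mem_maxTrivSubmodule K L L a).mp ha b]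
    simp
  let χ : Module.Dual K L := LinearMap.trace K L ∘ₗ (LieAlgebra.ad K L : L →ₗ[K] Module.End K L)
  have hχ : χ ∈ LinearMap.range (killingForm K L) := by
    have h : χ ∈ LinearMap.range (killingForm K L).dualMap := by
      rw [LinearMap.range_dualMap_eq_dualAnnihilator_ker, Submodule.mem_dualAnnihilator]
      intro a ha
      have : LieAlgebra.ad K L a = 0 :=
        ad_center (mem_center fun b ↦ LinearMap.congr_fun (LinearMap.mem_ker.mp ha) b)
      simp [χ, this]
    obtain ⟨φ, hφ⟩ := h
    obtain ⟨t, rfl⟩ := (Module.evalEquiv K L).surjective φ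
    refine ⟨t, LinearMap.ext fun y ↦ ?_⟩
    rw [LieModule.traceForm_comm, ← hφ]
    simp
  obtain ⟨t, ht⟩ := hχ
  have hχ_lie (y z : L) : χ ⁅y, z⁆ = 0 := LieModule.trace_toEnd_lie K L L y z
  have ht_lie (y : L) : ⁅t, y⁆ ∈ LieAlgebra.center K L := mem_center fun z ↦ by
    rw [LieModule.traceForm_apply_lie_apply, ht, hχ_lie]
  have had : LieAlgebra.ad K L x ∘ₗ LieAlgebra.ad K L t = 0 := by
    ext y
    exact (LieModule.mem_maxTrivSubmodule K L L _).mp (ht_lie y) x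
  have : χ x = 0 := by
    rw [← ht, LieModule.traceForm_comm]
    exact (congrArg (LinearMap.trace K L) had).trans (map_zero _)
  exact this

/-- The supertrace of an anticommutator of odd operators `ad v`, `ad w` vanishes. -/
theorem trace_toEnd_bracket_eq_trace_ad {K L M : Type*} [Field K]
    [LieRing L] [LieAlgebra K L] [FiniteDimensional K L]
    [AddCommGroup M] [Module K M] [FiniteDimensional K M] [LieRingModule L M] [LieModule K L M]
    (br : M →ₗ[K] M →ₗ[K] L)
    (hsymm : ∀ v w : M, br v w = br w v)
    (hequiv : ∀ (a : L) (v w : M), ⁅a, br v w⁆ = br ⁅a, v⁆ w + br v ⁅a, w⁆)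
    (hjac : ∀ u v w : M, ⁅br u v, w⁆ + ⁅br v w, u⁆ + ⁅br w u, v⁆ = 0) (v w : M) :
    LinearMap.trace K M (LieModule.toEnd K L M (br v w)) =
      LinearMap.trace K L (LieAlgebra.ad K L (br v w)) := by
  let act (m : M) : L →ₗ[K] M := -(LieModule.toEnd K L M : L →ₗ[K] Module.End K M).flip m
  have hM : LieModule.toEnd K L M (br v w) = act v ∘ₗ br w + act w ∘ₗ br v := by
    ext u
    have := hjac u v w
    rw [hsymm u v] at this
    simp only [act, LieModule.toEnd_apply_apply, LinearMap.add_apply, LinearMap.comp_apply,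
      LinearMap.neg_apply, LinearMap.flip_apply, LieHom.coe_toLinearMap]
    rw [← sub_eq_zero, ← this]
    abel
  have hL : LieAlgebra.ad K L (br v w) = br w ∘ₗ act v + br v ∘ₗ act w := by
    ext a
    simp only [act, LieAlgebra.ad_apply, LinearMap.add_apply, LinearMap.comp_apply, map_neg,
      LinearMap.neg_apply, LinearMap.flip_apply, LieHom.coe_toLinearMap,
      LieModule.toEnd_apply_apply]
    rw [← lie_skew, hequiv, hsymm ⁅a, v⁆ w]
    abel
  rw [hM, hL, map_add, map_add, LinearMap.trace_comp_comm', LinearMap.trace_comp_comm' (br v)]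

theorem stmt16
    (br : g1 →ₗ[F] g1 →ₗ[F] g0)
    (hsymm : ∀ v w : g1, br v w = br w v)
    (hequiv : ∀ (a : g0) (v w : g1), ⁅a, br v w⁆ = br ⁅a, v⁆ w + br v ⁅a, w⁆)
    (hjac : ∀ u v w : g1, ⁅br u v, w⁆ + ⁅br v w, u⁆ + ⁅br w u, v⁆ = 0)
    (hred : LieAlgebra.radical F g0 = LieAlgebra.center F g0)
    (hss : ∀ N : LieSubmodule F g0 g1, ∃ N', IsCompl N N') :
    (∀ v w : g1, LinearMap.trace F g1 (LieModule.toEnd F g0 g1 (br v w)) = 0) ∧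
    (∀ a b : g0, LinearMap.trace F g1 (LieModule.toEnd F g0 g1 ⁅a, b⁆) = 0) := by
  have : LieAlgebra.HasCentralRadical F g0 := ⟨hred⟩
  refine ⟨fun v w ↦ ?_, fun a b ↦ LieModule.trace_toEnd_lie F g0 g1 a b⟩
  rw [trace_toEnd_bracket_eq_trace_ad br hsymm hequiv hjac,
    LieAlgebra.trace_ad_eq_zero_of_hasCentralRadical]
end
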